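/- Let ℙ be a probability measure on Ω₊ under which (ω(x))_{x≥0} is stationary and ergodic, and assume ℙ[ω(0) = (1, 1/2, 1/2, 1/2, …)] < 1. Then the walk (X_n)_{n≥0} is recurrent (i.e., every x ≥ 0 is ℙ-a.s. ω-recurrent) if and only if 𝔼[δ^0] ≤ 1, where δ^0(ω) := Σ_{i≥1} (2ω(0,i) − 1); otherwise the walk is transient (every x ≥ 0 is ℙ-a.s. ω-transient). -/

import Mathlib

open MeasureTheory Filter Set Topology ProbabilityTheory
open scoped ENNReal ENat

noncomputable section

/-- A cookie environment: `ω z i` is the strength of the `(i+1)`-st cookie at site `z`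
(cookies at each site are indexed by `i = 0, 1, 2, …`). -/
abbrev CEnv : Type := ℤ → ℕ → ℝ

/-- `ω` belongs to `Ω₊`, i.e. all cookie strengths lie in `[1/2, 1]`. -/
def IsCookieEnv (ω : CEnv) : Prop := ∀ z i, ω z i ∈ Set.Icc (1/2 : ℝ) 1

/-- The number of visits of the path `x` to the site `x n` at times `m < n`. -/
def prevVisits (x : ℕ → ℤ) (n : ℕ) : ℕ :=
  ((Finset.range n).filter fun m => x m = x n).card

/-- The probability of the step from `x n` to `x (n+1)` for the multi-excited random
walk: jump to the right with the strength of the bottom remaining cookie at the current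
site, to the left with the complementary probability. -/
def stepProb (ω : CEnv) (x : ℕ → ℤ) (n : ℕ) : ℝ :=
  if x (n+1) = x n + 1 then ω (x n) (prevVisits x n)
  else if x (n+1) = x n - 1 then 1 - ω (x n) (prevVisits x n)
  else 0

/-- The probability that the walk started at `x0` follows the path `x` up to time `n`. -/
def cylProb (ω : CEnv) (x0 : ℤ) (x : ℕ → ℤ) (n : ℕ) : ℝ :=
  (if x 0 = x0 then 1 else 0) * ∏ m ∈ Finset.range n, stepProb ω x m

/-- `P` is the law `P_{x0,ω}` of the multi-excited random walk in the cookie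
environment `ω` started at `x0`, characterized by its cylinder probabilities. -/
def IsERWLaw (ω : CEnv) (x0 : ℤ) (P : Measure (ℕ → ℤ)) : Prop :=
  IsProbabilityMeasure P ∧
    ∀ (x : ℕ → ℤ) (n : ℕ),
      P {Y | ∀ m ≤ n, Y m = x m} = ENNReal.ofReal (cylProb ω x0 x n)

/-- First passage time `T_k`, with value `∞` if `k` is never visited. -/
def T (k : ℤ) (Y : ℕ → ℤ) : ℕ∞ :=
  sInf {t : ℕ∞ | ∃ n : ℕ, (n : ℕ∞) = t ∧ Y n = k}

/-- First passage time of an extended-real level, with the convention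
`T_{−∞} = T_{+∞} = ∞`. -/
def Te (k : EReal) (Y : ℕ → ℤ) : ℕ∞ :=
  sInf {t : ℕ∞ | ∃ n : ℕ, (n : ℕ∞) = t ∧ ((Y n : ℝ) : EReal) = k}

/-- `R_k`, the event that the site `k` is visited infinitely often. -/
def Rset (k : ℤ) : Set (ℕ → ℤ) := {Y | ∀ N : ℕ, ∃ n ≥ N, Y n = k}

/-- The number of visits of `Y` to the site `s` at times `< t`. -/
def visitsBefore (Y : ℕ → ℤ) (s : ℤ) (t : ℕ∞) : ℕ∞ :=
  {m : ℕ | (m : ℕ∞) < t ∧ Y m = s}.encard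

/-- `D_t^s`: the total drift stored in the cookies consumed at the site `s`
before time `t` (a time in `ℕ∞`; `t = ∞` gives `D_∞^s`). -/
def driftAt (ω : CEnv) (Y : ℕ → ℤ) (s : ℤ) (t : ℕ∞) : ℝ≥0∞ :=
  ∑' i : ℕ, Set.indicator {i : ℕ | (i : ℕ∞) < visitsBefore Y s t}
    (fun i => ENNReal.ofReal (2 * ω s i - 1)) i

/-- `D_t`: the total drift consumed before time `t` (at all sites). -/
def Dtot (ω : CEnv) (Y : ℕ → ℤ) (t : ℕ∞) : ℝ≥0∞ := ∑' s : ℤ, driftAt ω Y s t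

/-- `D_t^+`: the total drift consumed at nonnegative sites before time `t`. -/
def DtotPos (ω : CEnv) (Y : ℕ → ℤ) (t : ℕ∞) : ℝ≥0∞ := ∑' s : ℕ, driftAt ω Y (s : ℤ) t

/-- `δ^s`: the total drift stored in the cookies at the site `s`. -/
def cookieDrift (ω : CEnv) (s : ℤ) : ℝ≥0∞ := ∑' i : ℕ, ENNReal.ofReal (2 * ω s i - 1)

/-- The successive times `τ_{k,1}, τ_{k,2}, …` (indexed here from `0`) at which the
walk is at a site `≥ k`. -/
def tauT (k : ℤ) (Y : ℕ → ℤ) : ℕ → ℕ∞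
  | 0 => sInf {t : ℕ∞ | ∃ n : ℕ, (n : ℕ∞) = t ∧ k ≤ Y n}
  | m + 1 => sInf {t : ℕ∞ | ∃ n : ℕ, (n : ℕ∞) = t ∧ tauT k Y m < (n : ℕ∞) ∧ k ≤ Y n}

/-- The observed sequence `(X_{τ_{k,m}})_{m ≥ 1}` (indexed here from `0`). -/
def obsSeq (k : ℤ) (Y : ℕ → ℤ) (m : ℕ) : ℤ := Y (tauT k Y m).toNat

/-- The one-sided shift on sequences. -/
def shiftSeq {α : Type*} (u : ℕ → α) : ℕ → α := fun n => u (n + 1)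

/-- The restriction `(ω(x))_{x ≥ 0}` of an environment to the nonnegative sites. -/
def restrictNN (ω : CEnv) : ℕ → ℕ → ℝ := fun x => ω (x : ℤ)

/-- `(ω(x))_{x ≥ 0}` is stationary under `Pr`: its law is invariant under the shift. -/
def IsStationaryEnv (Pr : Measure CEnv) : Prop :=
  MeasurePreserving shiftSeq (Pr.map restrictNN) (Pr.map restrictNN)

/-- `(ω(x))_{x ≥ 0}` is stationary and ergodic under `Pr`. -/
def IsStatErgEnv (Pr : Measure CEnv) : Prop :=
  Ergodic shiftSeq (Pr.map restrictNN)

/-- The process `ξ_k = ((ω(x+k))_{x≥0}, (X_{τ_{k,m}} − k)_{m≥0})` consisting of the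
environment to the right of `k` and the trajectory at sites `≥ k`, recentered at `k`. -/
def xiProc (p : CEnv × (ℕ → ℤ)) (k : ℕ) : (ℕ → ℕ → ℝ) × (ℕ → ℤ) :=
  (fun x : ℕ => p.1 ((x : ℤ) + (k : ℤ)), fun m => obsSeq (k : ℤ) p.2 m - (k : ℤ))

section ProductMeasure

variable {ι X : Type*} [MeasurableSpace X]

/-- Resampling one coordinate of an i.i.d. family does not change its law. -/
theorem measurePreserving_update_infinitePi [DecidableEq ι] (ν : Measure X)
    [IsProbabilityMeasure ν] (k : ι) :
    MeasurePreserving (fun p : (ι → X) × X => Function.update p.1 k p.2)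
      ((Measure.infinitePi fun _ : ι => ν).prod ν) (Measure.infinitePi fun _ : ι => ν) := by
  have hm : Measurable (fun p : (ι → X) × X => Function.update p.1 k p.2) := by
    refine measurable_pi_iff.2 fun i => ?_
    rcases eq_or_ne i k with rfl | h
    · simpa using measurable_snd
    · simp only [Function.update_of_ne h]; fun_prop
  refine ⟨hm, ?_⟩
  refine Measure.eq_infinitePi _ fun s t ht => ?_
  rw [Measure.map_apply hm (MeasurableSet.pi s.countable_toSet fun i _ => ht i)]
  have : (fun p : (ι → X) × X => Function.update p.1 k p.2) ⁻¹' (Set.pi s t)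
      = (Set.pi (s.erase k) t) ×ˢ (if k ∈ s then t k else univ) := by
    ext ⟨u, v⟩
    simp only [mem_preimage, Set.mem_pi, Finset.mem_coe, mem_prod, Finset.mem_erase]
    constructor
    · intro h
      refine ⟨fun i hi => by simpa [Function.update_of_ne hi.1] using h i hi.2, ?_⟩
      split_ifs with hk
      · simpa using h k hk
      · trivial
    · rintro ⟨h1, h2⟩ i hi
      rcases eq_or_ne i k with rfl | hne
      · simpa [hi] using h2
      · simpa [Function.update_of_ne hne] using h1 i ⟨hne, hi⟩
  rw [this, Measure.prod_prod]
  have e := Measure.infinitePi_pi (fun _ : ι => ν) (s := s.erase k) (t := t) (fun i _ => ht i)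
  rw [e]
  split_ifs with hk
  · rw [Finset.prod_erase_mul s (fun i => ν (t i)) hk]
  · simp [Finset.erase_eq_of_notMem hk]

theorem lintegral_infinitePi_update [DecidableEq ι] (ν : Measure X)
    [IsProbabilityMeasure ν] (k : ι) {f : (ι → X) → ℝ≥0∞} (hf : Measurable f) :
    ∫⁻ u, f u ∂(Measure.infinitePi fun _ : ι => ν)
      = ∫⁻ u, ∫⁻ v, f (Function.update u k v) ∂ν ∂(Measure.infinitePi fun _ : ι => ν) := by
  have h := measurePreserving_update_infinitePi (ι := ι) ν k
  rw [← h.lintegral_comp hf]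
  exact lintegral_prod _ (hf.comp h.measurable).aemeasurable

theorem measurePreserving_reindex_infinitePi {κ : Type*} (ν : Measure X)
    [IsProbabilityMeasure ν] {g : κ → ι} (hg : Function.Injective g) :
    MeasurePreserving (fun (u : ι → X) j => u (g j)) (Measure.infinitePi fun _ : ι => ν)
      (Measure.infinitePi fun _ : κ => ν) :=
  ⟨by fun_prop, Measure.map_infinitePi_infinitePi_of_inj (P := fun _ : ι => ν) hg⟩

end ProductMeasure

/-- The uniform distribution on `[0, 1]`. -/
def unifLaw : Measure ℝ := volume.restrict (Set.Icc 0 1)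

instance : IsProbabilityMeasure unifLaw := ⟨by simp [unifLaw]⟩

theorem unifLaw_Iic {a : ℝ} (ha : a ∈ Set.Icc (0 : ℝ) 1) :
    unifLaw {w | w ≤ a} = ENNReal.ofReal a := by
  have : {w : ℝ | w ≤ a} ∩ Set.Icc 0 1 = Set.Icc 0 a := by
    ext w; simp only [mem_inter_iff, mem_ofPred_eq, Set.mem_Icc]
    constructor
    · rintro ⟨h1, h2, -⟩; exact ⟨h2, h1⟩
    · rintro ⟨h1, h2⟩; exact ⟨h2, h1, h2.trans ha.2⟩
  have hm : MeasurableSet {w : ℝ | w ≤ a} := measurableSet_le measurable_id measurable_const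
  rw [unifLaw, Measure.restrict_apply hm, this]
  simp

theorem unifLaw_Ioi {a : ℝ} (ha : a ∈ Set.Icc (0 : ℝ) 1) :
    unifLaw {w | ¬ w ≤ a} = ENNReal.ofReal (1 - a) := by
  have h := prob_compl_eq_one_sub (μ := unifLaw)
    (measurableSet_le measurable_id measurable_const : MeasurableSet {w : ℝ | w ≤ a})
  rw [unifLaw_Iic ha] at h
  rw [ENNReal.ofReal_sub _ ha.1, ENNReal.ofReal_one, ← h]
  rfl

theorem lintegral_unifLaw_ite {a : ℝ} (ha : a ∈ Set.Icc (0 : ℝ) 1) (A B : ℝ≥0∞) :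
    ∫⁻ w, (if w ≤ a then A else B) ∂unifLaw
      = ENNReal.ofReal a * A + ENNReal.ofReal (1 - a) * B := by
  have hm : MeasurableSet {w : ℝ | w ≤ a} := measurableSet_le measurable_id measurable_const
  have : (fun w : ℝ => if w ≤ a then A else B)
      = fun w => {w : ℝ | w ≤ a}.indicator (fun _ => A) w
          + {w : ℝ | ¬ w ≤ a}.indicator (fun _ => B) w := by
    funext w
    by_cases h : w ≤ a <;> simp [Set.indicator, h]
    simp [not_lt.2 h]
  have hm' : MeasurableSet {w : ℝ | ¬ w ≤ a} := hm.compl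
  rw [this, lintegral_add_left (measurable_const.indicator hm), lintegral_indicator_const hm,
    lintegral_indicator_const hm', unifLaw_Iic ha, unifLaw_Ioi ha, mul_comm A, mul_comm B]

/-- The number of right arrows among the first `i` arrows at a site with cookie strengths `c` and
uniform variables `v`; the `i`-th arrow points to the right iff `v i ≤ c i`. -/
def nRight (c v : ℕ → ℝ) : ℕ → ℕ
  | 0 => 0
  | i + 1 => nRight c v i + if v i ≤ c i then 1 else 0

/-- The number of left arrows before the `m`-th right arrow. -/
def leftsBefore (c v : ℕ → ℝ) (m : ℝ≥0∞) : ℝ≥0∞ :=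
  ∑' i, if (nRight c v i : ℝ≥0∞) < m ∧ ¬ v i ≤ c i then 1 else 0

/-- The number of right arrows up to the `m`-th right arrow. -/
def rightsBefore (c v : ℕ → ℝ) (m : ℝ≥0∞) : ℝ≥0∞ :=
  ∑' i, if (nRight c v i : ℝ≥0∞) < m ∧ v i ≤ c i then 1 else 0

/-- The drift stored in the cookies consumed up to the `m`-th right arrow. -/
def driftBefore (c v : ℕ → ℝ) (m : ℝ≥0∞) : ℝ≥0∞ :=
  ∑' i, if (nRight c v i : ℝ≥0∞) < m then ENNReal.ofReal (2 * c i - 1) else 0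

/-- There are infinitely many right arrows. -/
def InfRight (c v : ℕ → ℝ) : Prop := ∀ m : ℕ, ∃ i, m ≤ nRight c v i

/-- The law of the uniform variables at one site. -/
def siteLaw : Measure (ℕ → ℝ) := Measure.infinitePi fun _ => unifLaw

instance : IsProbabilityMeasure siteLaw := by unfold siteLaw; infer_instance

theorem measurable_nRight (i : ℕ) :
    Measurable fun p : (ℕ → ℝ) × (ℕ → ℝ) => nRight p.1 p.2 i := by
  induction i with
  | zero => exact measurable_const
  | succ i ih =>
    refine ih.add (Measurable.ite (measurableSet_le ?_ ?_) measurable_const measurable_const)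
    all_goals fun_prop

theorem measurableSet_nRight_lt (i : ℕ) :
    MeasurableSet {p : ((ℕ → ℝ) × (ℕ → ℝ)) × ℝ≥0∞ | (nRight p.1.1 p.1.2 i : ℝ≥0∞) < p.2} :=
  measurableSet_lt ((measurable_from_top (f := fun n : ℕ => (n : ℝ≥0∞))).comp
    ((measurable_nRight i).comp measurable_fst)) measurable_snd

theorem measurableSet_arrow (i : ℕ) :
    MeasurableSet {p : ((ℕ → ℝ) × (ℕ → ℝ)) × ℝ≥0∞ | p.1.2 i ≤ p.1.1 i} := by
  apply measurableSet_le <;> fun_prop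

theorem measurable_leftsBefore :
    Measurable fun p : ((ℕ → ℝ) × (ℕ → ℝ)) × ℝ≥0∞ => leftsBefore p.1.1 p.1.2 p.2 :=
  Measurable.tsum fun i => Measurable.ite
    ((measurableSet_nRight_lt i).inter (measurableSet_arrow i).compl)
    measurable_const measurable_const

theorem measurable_driftBefore :
    Measurable fun p : ((ℕ → ℝ) × (ℕ → ℝ)) × ℝ≥0∞ => driftBefore p.1.1 p.1.2 p.2 :=
  Measurable.tsum fun i => Measurable.ite (measurableSet_nRight_lt i)
    (by fun_prop) measurable_const

theorem measurable_nRight_right (c : ℕ → ℝ) (i : ℕ) : Measurable fun v => nRight c v i :=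
  (measurable_nRight i).comp (measurable_const.prodMk measurable_id)

theorem measurable_leftsBefore_right (c : ℕ → ℝ) (m : ℝ≥0∞) :
    Measurable fun v => leftsBefore c v m :=
  measurable_leftsBefore.comp ((measurable_const.prodMk measurable_id).prodMk measurable_const)

theorem leftsBefore_mono (c v : ℕ → ℝ) : Monotone (leftsBefore c v) := by
  intro m m' h
  refine ENNReal.tsum_le_tsum fun i => ?_
  split_ifs with h1 h2 <;> first | exact le_rfl | exact zero_le | skip
  exact absurd ⟨h1.1.trans_le h, h1.2⟩ h2

theorem driftBefore_mono (c v : ℕ → ℝ) : Monotone (driftBefore c v) := by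
  intro m m' h
  refine ENNReal.tsum_le_tsum fun i => ?_
  split_ifs with h1 h2 <;> first | exact le_rfl | exact zero_le | skip
  exact absurd (h1.trans_le h) h2

theorem driftBefore_le (c v : ℕ → ℝ) (m : ℝ≥0∞) :
    driftBefore c v m ≤ ∑' i, ENNReal.ofReal (2 * c i - 1) := by
  refine ENNReal.tsum_le_tsum fun i => ?_
  split_ifs <;> simp

theorem nRight_mono (c v : ℕ → ℝ) : Monotone (nRight c v) :=
  monotone_nat_of_le_succ fun i => by simp [nRight]

theorem nRight_le (c v : ℕ → ℝ) (i : ℕ) : nRight c v i ≤ i := by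
  induction i with
  | zero => simp [nRight]
  | succ i ih => simp only [nRight]; split_ifs <;> omega

theorem nRight_update (c v : ℕ → ℝ) (w : ℝ) {i j : ℕ} (h : j ≤ i) :
    nRight c (Function.update v i w) j = nRight c v j := by
  induction j with
  | zero => rfl
  | succ j ih =>
    simp only [nRight, ih (by omega), Function.update_of_ne (show j ≠ i by omega)]

theorem lintegral_siteLaw_ite {c : ℕ → ℝ} {i : ℕ} (hc : c i ∈ Set.Icc (0 : ℝ) 1)
    {A B : (ℕ → ℝ) → ℝ≥0∞} (hA : Measurable A) (hB : Measurable B)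
    (hA' : ∀ v w, A (Function.update v i w) = A v)
    (hB' : ∀ v w, B (Function.update v i w) = B v) :
    ∫⁻ v, (if v i ≤ c i then A v else B v) ∂siteLaw
      = ENNReal.ofReal (c i) * ∫⁻ v, A v ∂siteLaw
        + ENNReal.ofReal (1 - c i) * ∫⁻ v, B v ∂siteLaw := by
  have hm : Measurable fun v : ℕ → ℝ => if v i ≤ c i then A v else B v :=
    Measurable.ite (measurableSet_le (measurable_pi_apply i) measurable_const) hA hB
  rw [siteLaw, lintegral_infinitePi_update unifLaw i hm]
  simp only [Function.update_self, hA', hB', lintegral_unifLaw_ite hc]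
  rw [lintegral_add_left (hA.const_mul _), lintegral_const_mul _ hA, lintegral_const_mul _ hB]

theorem half_to_unit {a : ℝ} (h : a ∈ Set.Icc (1/2 : ℝ) 1) : a ∈ Set.Icc (0 : ℝ) 1 :=
  ⟨by linarith [h.1], h.2⟩

/-- Wald's identity at one site, for the number of right arrows. -/
theorem lintegral_leftsBefore_add_rights {c : ℕ → ℝ} (hc : ∀ i, c i ∈ Set.Icc (1/2 : ℝ) 1)
    (m : ℝ≥0∞) :
    ∫⁻ v, leftsBefore c v m ∂siteLaw + ∫⁻ v, driftBefore c v m ∂siteLaw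
      = ∫⁻ v, rightsBefore c v m ∂siteLaw := by
  have hS : ∀ i, MeasurableSet {v : ℕ → ℝ | (nRight c v i : ℝ≥0∞) < m} := fun i =>
    measurableSet_lt ((measurable_from_top (f := fun n : ℕ => (n : ℝ≥0∞))).comp
      (measurable_nRight_right c i)) measurable_const
  have hR : ∀ i, MeasurableSet {v : ℕ → ℝ | v i ≤ c i} := fun i =>
    measurableSet_le (measurable_pi_apply i) measurable_const
  have hA : ∀ i, Measurable fun v : ℕ → ℝ =>
      if (nRight c v i : ℝ≥0∞) < m then (1 : ℝ≥0∞) else 0 := fun i =>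
    Measurable.ite (hS i) measurable_const measurable_const
  have hA' : ∀ i, ∀ (v : ℕ → ℝ) (w : ℝ),
      (if (nRight c (Function.update v i w) i : ℝ≥0∞) < m then (1 : ℝ≥0∞) else 0)
        = if (nRight c v i : ℝ≥0∞) < m then (1 : ℝ≥0∞) else 0 := fun i v w => by
    rw [nRight_update _ _ _ le_rfl]
  have e1 : ∀ i, ∫⁻ v, (if (nRight c v i : ℝ≥0∞) < m ∧ ¬ v i ≤ c i then (1 : ℝ≥0∞) else 0) ∂siteLaw
      = ENNReal.ofReal (1 - c i) *
        ∫⁻ v, (if (nRight c v i : ℝ≥0∞) < m then (1 : ℝ≥0∞) else 0) ∂siteLaw := fun i => by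
    have := lintegral_siteLaw_ite (half_to_unit (hc i)) measurable_const (hA i)
      (A := fun _ => 0) (fun _ _ => rfl) (hA' i)
    simp only [lintegral_zero, mul_zero, zero_add] at this
    rw [← this]
    refine lintegral_congr fun v => ?_
    by_cases h : v i ≤ c i <;> simp [h]
  have e2 : ∀ i, ∫⁻ v, (if (nRight c v i : ℝ≥0∞) < m ∧ v i ≤ c i then (1 : ℝ≥0∞) else 0) ∂siteLaw
      = ENNReal.ofReal (c i) *
        ∫⁻ v, (if (nRight c v i : ℝ≥0∞) < m then (1 : ℝ≥0∞) else 0) ∂siteLaw := fun i => by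
    have := lintegral_siteLaw_ite (half_to_unit (hc i)) (hA i) measurable_const
      (B := fun _ => 0) (hA' i) (fun _ _ => rfl)
    simp only [lintegral_zero, mul_zero, add_zero] at this
    rw [← this]
    refine lintegral_congr fun v => ?_
    by_cases h : v i ≤ c i <;> simp [h]
  have e3 : ∀ i, ∫⁻ v, (if (nRight c v i : ℝ≥0∞) < m then ENNReal.ofReal (2 * c i - 1) else 0)
      ∂siteLaw = ENNReal.ofReal (2 * c i - 1) *
        ∫⁻ v, (if (nRight c v i : ℝ≥0∞) < m then (1 : ℝ≥0∞) else 0) ∂siteLaw := fun i => by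
    rw [← lintegral_const_mul _ (hA i)]
    refine lintegral_congr fun v => ?_
    split_ifs <;> simp
  have m1 : ∀ i, Measurable fun v : ℕ → ℝ =>
      if (nRight c v i : ℝ≥0∞) < m ∧ ¬ v i ≤ c i then (1 : ℝ≥0∞) else 0 := fun i =>
    Measurable.ite ((hS i).inter (hR i).compl) measurable_const measurable_const
  have m2 : ∀ i, Measurable fun v : ℕ → ℝ =>
      if (nRight c v i : ℝ≥0∞) < m ∧ v i ≤ c i then (1 : ℝ≥0∞) else 0 := fun i =>
    Measurable.ite ((hS i).inter (hR i)) measurable_const measurable_const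
  have m3 : ∀ i, Measurable fun v : ℕ → ℝ =>
      if (nRight c v i : ℝ≥0∞) < m then ENNReal.ofReal (2 * c i - 1) else 0 := fun i =>
    Measurable.ite (hS i) measurable_const measurable_const
  unfold leftsBefore rightsBefore driftBefore
  rw [lintegral_tsum fun i => (m1 i).aemeasurable, lintegral_tsum fun i => (m2 i).aemeasurable,
    lintegral_tsum fun i => (m3 i).aemeasurable, ← ENNReal.tsum_add]
  refine tsum_congr fun i => ?_
  rw [e1, e2, e3, ← add_mul, ← ENNReal.ofReal_add (by linarith [(hc i).2])
    (by linarith [(hc i).1])]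
  ring_nf

theorem sum_rights (c v : ℕ → ℝ) (m n : ℕ) :
    ∑ i ∈ Finset.range n, (if (nRight c v i : ℝ≥0∞) < (m : ℝ≥0∞) ∧ v i ≤ c i
      then (1 : ℝ≥0∞) else 0) = ((min (nRight c v n) m : ℕ) : ℝ≥0∞) := by
  induction n with
  | zero => simp [nRight]
  | succ n ih =>
    rw [Finset.sum_range_succ, ih, nRight]
    simp only [Nat.cast_lt]
    by_cases h : v n ≤ c n
    · by_cases h' : nRight c v n < m
      · simp only [h, h', and_self, if_true]
        rw [min_eq_left h'.le, min_eq_left h']; push_cast; rfl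
      · simp only [h, h', if_false, if_true, false_and, add_zero]
        rw [min_eq_right (by omega), min_eq_right (by omega)]
    · simp [h]

theorem rightsBefore_le (c v : ℕ → ℝ) (m : ℕ) : rightsBefore c v m ≤ m := by
  unfold rightsBefore
  rw [ENNReal.tsum_eq_iSup_nat]
  refine iSup_le fun n => ?_
  rw [sum_rights]
  exact_mod_cast min_le_right _ _

theorem rightsBefore_eq {c v : ℕ → ℝ} (h : InfRight c v) (m : ℕ) : rightsBefore c v m = m := by
  refine le_antisymm (rightsBefore_le c v m) ?_
  obtain ⟨i, hi⟩ := h m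
  calc (m : ℝ≥0∞) = ((min (nRight c v i) m : ℕ) : ℝ≥0∞) := by rw [min_eq_right hi]
    _ = _ := (sum_rights c v m i).symm
    _ ≤ _ := ENNReal.sum_le_tsum _

theorem ae_infRight {c : ℕ → ℝ} (hc : ∀ i, c i ∈ Set.Icc (1/2 : ℝ) 1) :
    ∀ᵐ v ∂siteLaw, InfRight c v := by
  refine ae_all_iff.2 fun m => ?_
  set p : ℕ → ℝ≥0∞ := fun i => siteLaw {v | nRight c v i < m} with hp
  have hS : ∀ i, MeasurableSet {v : ℕ → ℝ | nRight c v i < m} := fun i =>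
    measurableSet_lt (measurable_nRight_right c i) measurable_const
  have hle : ∑' i, p i ≤ 2 * m := by
    have hsum : ∑' i, ENNReal.ofReal (c i) * p i ≤ m := by
      calc ∑' i, ENNReal.ofReal (c i) * p i = ∫⁻ v, rightsBefore c v m ∂siteLaw := by
            unfold rightsBefore
            rw [lintegral_tsum]
            · refine tsum_congr fun i => ?_
              have := lintegral_siteLaw_ite (half_to_unit (hc i))
                (A := {v : ℕ → ℝ | nRight c v i < m}.indicator 1) (B := fun _ => 0)
                (measurable_one.indicator (hS i)) measurable_const
                (fun v w => by simp [Set.indicator, nRight_update]) (fun _ _ => rfl)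
              rw [lintegral_indicator_one (hS i)] at this
              simp only [lintegral_zero, mul_zero, add_zero] at this
              rw [hp, ← this]
              refine lintegral_congr fun v => ?_
              by_cases h : v i ≤ c i <;> simp [h, Set.indicator]
            · intro i
              have hR : MeasurableSet {v : ℕ → ℝ | v i ≤ c i} :=
                measurableSet_le (measurable_pi_apply i) measurable_const
              have : Measurable fun v : ℕ → ℝ =>
                  if nRight c v i < m ∧ v i ≤ c i then (1 : ℝ≥0∞) else 0 :=
                Measurable.ite ((hS i).inter hR) measurable_const measurable_const
              simpa using this.aemeasurable
        _ ≤ ∫⁻ v, m ∂siteLaw := lintegral_mono fun v => rightsBefore_le c v m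
        _ = m := by simp
    calc ∑' i, p i ≤ ∑' i, 2 * (ENNReal.ofReal (c i) * p i) := by
          refine ENNReal.tsum_le_tsum fun i => ?_
          rw [← mul_assoc]
          refine le_mul_of_one_le_left zero_le ?_
          calc (1 : ℝ≥0∞) = ENNReal.ofReal (2 * (1/2)) := by norm_num
            _ ≤ ENNReal.ofReal (2 * c i) := ENNReal.ofReal_le_ofReal (by linarith [(hc i).1])
            _ = 2 * ENNReal.ofReal (c i) := by
              rw [ENNReal.ofReal_mul (by norm_num)]; norm_num
      _ = 2 * ∑' i, ENNReal.ofReal (c i) * p i := ENNReal.tsum_mul_left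
      _ ≤ 2 * m := by gcongr
  have htend : Tendsto p atTop (𝓝 0) :=
    ENNReal.tendsto_atTop_zero_of_tsum_ne_top
      (ne_top_of_le_ne_top (ENNReal.mul_ne_top (by simp) (by simp)) hle)
  refine le_antisymm (ge_of_tendsto' htend fun i => ?_) zero_le
  refine measure_mono fun v hv => ?_
  simp only [mem_compl_iff, mem_ofPred_eq, not_exists, not_le] at hv
  exact hv i

/-- Wald's identity at one site. -/
theorem lintegral_leftsBefore_add {c : ℕ → ℝ} (hc : ∀ i, c i ∈ Set.Icc (1/2 : ℝ) 1)
    {m : ℝ≥0∞} (hm : m ∈ range (fun k : ℕ∞ => (k : ℝ≥0∞))) :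
    ∫⁻ v, leftsBefore c v m ∂siteLaw + ∫⁻ v, driftBefore c v m ∂siteLaw = m := by
  have key : ∀ k : ℕ,
      ∫⁻ v, leftsBefore c v k ∂siteLaw + ∫⁻ v, driftBefore c v k ∂siteLaw = k := fun k => by
    rw [lintegral_leftsBefore_add_rights hc]
    calc ∫⁻ v, rightsBefore c v k ∂siteLaw = ∫⁻ _, (k : ℝ≥0∞) ∂siteLaw := by
          refine lintegral_congr_ae ?_
          filter_upwards [ae_infRight hc] with v hv using rightsBefore_eq hv k
      _ = k := by simp
  obtain ⟨k, rfl⟩ := hm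
  induction k using ENat.recTopCoe with
  | coe k => simpa using key k
  | top =>
    refine (top_le_iff.1 (ENNReal.le_of_forall_nnreal_lt fun r _ => ?_)).trans (by simp)
    obtain ⟨n, hn⟩ := exists_nat_ge r
    calc (r : ℝ≥0∞) ≤ (n : ℝ≥0∞) := by exact_mod_cast hn
      _ = _ := (key n).symm
      _ ≤ _ := by
        gcongr with v v
        · exact leftsBefore_mono c v (by simp)
        · exact driftBefore_mono c v (by simp)

theorem leftsBefore_mem_range (c v : ℕ → ℝ) (m : ℝ≥0∞) :
    leftsBefore c v m ∈ range (fun k : ℕ∞ => (k : ℝ≥0∞)) := by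
  refine ⟨{i | (nRight c v i : ℝ≥0∞) < m ∧ ¬ v i ≤ c i}.encard, ?_⟩
  change (({i | (nRight c v i : ℝ≥0∞) < m ∧ ¬ v i ≤ c i}.encard : ℕ∞) : ℝ≥0∞) = _
  rw [← ENNReal.tsum_set_one, tsum_subtype _ (fun _ => (1 : ℝ≥0∞))]
  exact tsum_congr fun i => by simp [Set.indicator]

theorem leftsBefore_le_of_le_nRight {c v : ℕ → ℝ} {m : ℝ≥0∞} {i : ℕ}
    (h : m ≤ (nRight c v i : ℝ≥0∞)) : leftsBefore c v m ≤ i := by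
  unfold leftsBefore
  rw [tsum_eq_sum (s := Finset.range i)]
  · calc _ ≤ ∑ _j ∈ Finset.range i, (1 : ℝ≥0∞) :=
          Finset.sum_le_sum fun j _ => by split_ifs <;> simp
      _ = i := by simp
  · intro j hj
    have : nRight c v i ≤ nRight c v j := nRight_mono c v (by simpa using hj)
    rw [if_neg]
    rintro ⟨h', -⟩
    exact absurd (h'.trans_le h) (by simpa using this)

theorem leftsBefore_ne_top {c v : ℕ → ℝ} (h : InfRight c v) {m : ℝ≥0∞} (hm : m ≠ ⊤) :
    leftsBefore c v m ≠ ⊤ := by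
  obtain ⟨n, hn⟩ := ENNReal.exists_nat_gt hm
  obtain ⟨i, hi⟩ := h n
  exact ne_top_of_le_ne_top (by simp)
    (leftsBefore_le_of_le_nRight (hn.le.trans (by exact_mod_cast hi)))

theorem nRight_eq_of_forall {c v : ℕ → ℝ} {k : ℕ} (h : ∀ i < k, v i ≤ c i) :
    ∀ i ≤ k, nRight c v i = i := by
  intro i hi
  induction i with
  | zero => rfl
  | succ i ih => simp [nRight, ih (by omega), h i (by omega)]

theorem leftsBefore_eq_zero {c v : ℕ → ℝ} {k : ℕ} (h : ∀ i < k, v i ≤ c i) {m : ℝ≥0∞}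
    (hm : m ≤ k) : leftsBefore c v m = 0 := by
  unfold leftsBefore
  refine ENNReal.tsum_eq_zero.2 fun i => if_neg ?_
  rintro ⟨h1, h2⟩
  have hk : nRight c v i < k := by exact_mod_cast h1.trans_le hm
  refine h2 (h i ?_)
  by_contra hik
  have := nRight_mono c v (not_lt.1 hik)
  rw [nRight_eq_of_forall h k le_rfl] at this
  omega

theorem measurableSet_forall_right (c : ℕ → ℝ) (k : ℕ) :
    MeasurableSet {v : ℕ → ℝ | ∀ i < k, v i ≤ c i} := by
  simp only [Set.ofPred_forall]
  exact MeasurableSet.iInter fun i => MeasurableSet.iInter fun _ =>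
    measurableSet_le (measurable_pi_apply i) measurable_const

theorem siteLaw_forall_right {c : ℕ → ℝ} (hc : ∀ i, c i ∈ Set.Icc (1/2 : ℝ) 1) (k : ℕ) :
    (2⁻¹ : ℝ≥0∞) ^ k ≤ siteLaw {v | ∀ i < k, v i ≤ c i} := by
  have : {v : ℕ → ℝ | ∀ i < k, v i ≤ c i}
      = Set.pi (Finset.range k : Finset ℕ) (fun i => {w : ℝ | w ≤ c i}) := by
    ext v; simp [Set.mem_pi]
  have hm : ∀ i, MeasurableSet {w : ℝ | w ≤ c i} := fun i =>
    measurableSet_le measurable_id measurable_const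
  rw [this, siteLaw, Measure.infinitePi_pi (fun _ : ℕ => unifLaw) (fun i _ => hm i)]
  calc (2⁻¹ : ℝ≥0∞) ^ k = ∏ _i ∈ Finset.range k, (2⁻¹ : ℝ≥0∞) := by simp
    _ ≤ _ := Finset.prod_le_prod' fun i _ => by
      rw [unifLaw_Iic (half_to_unit (hc i))]
      calc (2⁻¹ : ℝ≥0∞) = ENNReal.ofReal (1/2) := by
            rw [one_div, ENNReal.ofReal_inv_of_pos (by norm_num)]; simp
        _ ≤ _ := ENNReal.ofReal_le_ofReal (hc i).1

/-- The number of left arrows before the `m`-th right arrow among the first `n` arrows. -/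
def nLeftStop (c v : ℕ → ℝ) (m : ℕ) : ℕ → ℕ
  | 0 => 0
  | n + 1 => nLeftStop c v m n + if nRight c v n < m ∧ ¬ v n ≤ c n then 1 else 0

theorem measurable_nLeftStop (c : ℕ → ℝ) (m n : ℕ) :
    Measurable fun v => nLeftStop c v m n := by
  induction n with
  | zero => exact measurable_const
  | succ n ih =>
    refine ih.add (Measurable.ite (MeasurableSet.inter ?_ (MeasurableSet.compl ?_))
      measurable_const measurable_const)
    · exact measurableSet_lt (measurable_nRight_right c n) measurable_const
    · exact measurableSet_le (measurable_pi_apply n) measurable_const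

theorem nLeftStop_update (c v : ℕ → ℝ) (m : ℕ) (w : ℝ) {i j : ℕ} (h : j ≤ i) :
    nLeftStop c (Function.update v i w) m j = nLeftStop c v m j := by
  induction j with
  | zero => rfl
  | succ j ih =>
    simp only [nLeftStop, ih (by omega), Function.update_of_ne (show j ≠ i by omega),
      nRight_update c v w (show j ≤ i by omega)]

theorem leftsBefore_eq_iSup (c v : ℕ → ℝ) (m : ℕ) :
    leftsBefore c v m = ⨆ n, (nLeftStop c v m n : ℝ≥0∞) := by
  unfold leftsBefore
  rw [ENNReal.tsum_eq_iSup_nat]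
  refine iSup_congr fun n => ?_
  induction n with
  | zero => simp [nLeftStop]
  | succ n ih => rw [Finset.sum_range_succ, ih, nLeftStop]; simp

theorem monotone_nLeftStop (c v : ℕ → ℝ) (m : ℕ) : Monotone (nLeftStop c v m) :=
  monotone_nat_of_le_succ fun i => by simp [nLeftStop]

/-- The value `x² + 2xh + h² + 2h` of the expected square of the final number of left arrows, for
fair arrows, given `x` left arrows so far and `h` right arrows to go. -/
def quadPot (x h : ℕ) : ℕ := (x + h) ^ 2 + 2 * h

theorem quadPot_step {a : ℝ} (ha : a ∈ Set.Icc (1/2 : ℝ) 1) (x h : ℕ) :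
    ENNReal.ofReal a * (quadPot x h : ℝ≥0∞)
      + ENNReal.ofReal (1 - a) * (quadPot (x + 1) (h + 1) : ℝ≥0∞)
      ≤ (quadPot x (h + 1) : ℝ≥0∞) := by
  rw [← ENNReal.ofReal_natCast, ← ENNReal.ofReal_natCast, ← ENNReal.ofReal_natCast,
    ← ENNReal.ofReal_mul (by linarith [ha.1]), ← ENNReal.ofReal_mul (by linarith [ha.2]),
    ← ENNReal.ofReal_add (mul_nonneg (by linarith [ha.1]) (by positivity))
      (mul_nonneg (by linarith [ha.2]) (by positivity))]
  refine ENNReal.ofReal_le_ofReal ?_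
  simp only [quadPot]
  push_cast
  have hx : (0 : ℝ) ≤ x := by positivity
  have hh : (0 : ℝ) ≤ h := by positivity
  nlinarith [mul_nonneg (sub_nonneg.2 ha.1) hx, mul_nonneg (sub_nonneg.2 ha.1) hh, ha.1]

theorem lintegral_quadPot_le {c : ℕ → ℝ} (hc : ∀ i, c i ∈ Set.Icc (1/2 : ℝ) 1) (m n : ℕ) :
    ∫⁻ v, (quadPot (nLeftStop c v m n) (m - nRight c v n) : ℝ≥0∞) ∂siteLaw
      ≤ (quadPot 0 m : ℝ≥0∞) := by
  have meas : ∀ (f : ℕ → ℕ → ℕ) n,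
      Measurable fun v => ((f (nLeftStop c v m n) (nRight c v n) : ℕ) : ℝ≥0∞) := fun f n =>
    (measurable_of_countable (fun p : ℕ × ℕ => ((f p.1 p.2 : ℕ) : ℝ≥0∞))).comp
      ((measurable_nLeftStop c m n).prodMk (measurable_nRight_right c n))
  induction n with
  | zero => simp [nLeftStop, nRight]
  | succ n ih =>
    refine le_trans ?_ ih
    have hm := meas (fun x r => quadPot x (m - r))
    rw [siteLaw, lintegral_infinitePi_update unifLaw n (hm (n + 1))]
    refine lintegral_mono fun v => ?_
    simp only [nLeftStop, nRight, nLeftStop_update c v m _ (le_refl n),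
      nRight_update c v _ (le_refl n), Function.update_self]
    by_cases h : nRight c v n < m
    · obtain ⟨k, hk⟩ : ∃ k, m - nRight c v n = k + 1 := ⟨m - nRight c v n - 1, by omega⟩
      have e : ∀ w : ℝ, ((quadPot (nLeftStop c v m n + if nRight c v n < m ∧ ¬ w ≤ c n then 1 else 0)
          (m - (nRight c v n + if w ≤ c n then 1 else 0)) : ℕ) : ℝ≥0∞)
          = if w ≤ c n then (quadPot (nLeftStop c v m n) k : ℝ≥0∞)
            else (quadPot (nLeftStop c v m n + 1) (k + 1) : ℝ≥0∞) := fun w => by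
        by_cases hw : w ≤ c n
        · simp only [hw, if_true, not_true, and_false, if_false, add_zero]
          congr 3; omega
        · simp only [hw, h, if_false, not_false_iff, and_self, if_true, add_zero, hk]
      simp only [e]
      rw [lintegral_unifLaw_ite (half_to_unit (hc n)), hk]
      exact quadPot_step (hc n) _ _
    · have e : ∀ w : ℝ, m - (nRight c v n + if w ≤ c n then 1 else 0) = m - nRight c v n := by
        intro w; omega
      simp [h, e]

theorem lintegral_leftsBefore_sq_le {c : ℕ → ℝ} (hc : ∀ i, c i ∈ Set.Icc (1/2 : ℝ) 1)
    {m : ℝ≥0∞} (hm : m ∈ range (fun k : ℕ∞ => (k : ℝ≥0∞))) :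
    ∫⁻ v, leftsBefore c v m ^ 2 ∂siteLaw ≤ m ^ 2 + 2 * m := by
  obtain ⟨k, rfl⟩ := hm
  induction k using ENat.recTopCoe with
  | top => simp
  | coe m =>
    have e : ∀ v, leftsBefore c v m ^ 2 = ⨆ n, (nLeftStop c v m n : ℝ≥0∞) ^ 2 := fun v => by
      rw [leftsBefore_eq_iSup, ENNReal.iSup_pow]
    simp only [ENat.toENNReal_coe, e]
    rw [lintegral_iSup]
    · refine iSup_le fun n => ?_
      calc _ ≤ ∫⁻ v, (quadPot (nLeftStop c v m n) (m - nRight c v n) : ℝ≥0∞) ∂siteLaw := by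
            refine lintegral_mono fun v => ?_
            simp only [quadPot]
            norm_cast
            nlinarith [Nat.zero_le (nLeftStop c v m n), Nat.zero_le (m - nRight c v n)]
        _ ≤ _ := lintegral_quadPot_le hc m n
        _ = _ := by simp [quadPot]
    · intro n
      exact ((measurable_from_top (f := fun n : ℕ => (n : ℝ≥0∞))).comp
        (measurable_nLeftStop c m n)).pow_const 2
    · intro i j hij v
      have := monotone_nLeftStop c v m hij
      simp only
      gcongr

/-- The law of the uniform variables at all nonnegative sites. -/
def fieldLaw : Measure (ℕ → ℕ → ℝ) := Measure.infinitePi fun _ => siteLaw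

instance : IsProbabilityMeasure fieldLaw := by unfold fieldLaw; infer_instance

/-- The number of steps from `0` to `-1` that the walk in the arrow field given by the strengths
`e` and the uniform variables `u` makes from `0` until its first passage at `n`. -/
def excur : ℕ → (ℕ → ℕ → ℝ) → (ℕ → ℕ → ℝ) → ℝ≥0∞
  | 0, _, _ => 0
  | n + 1, e, u => leftsBefore (e 0) (u 0) (excur n (shiftSeq e) (shiftSeq u) + 1)

/-- The total number of steps from `0` to `-1`. -/
def excurSup (e u : ℕ → ℕ → ℝ) : ℝ≥0∞ := ⨆ n, excur n e u

theorem measurable_shiftSeq {α : Type*} [MeasurableSpace α] :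
    Measurable (shiftSeq : (ℕ → α) → ℕ → α) := by
  unfold shiftSeq; fun_prop

theorem measurable_shift_prod {α β : Type*} [MeasurableSpace α] [MeasurableSpace β] :
    Measurable (Prod.map shiftSeq shiftSeq : (ℕ → α) × (ℕ → β) → (ℕ → α) × (ℕ → β)) :=
  measurable_shiftSeq.prodMap measurable_shiftSeq

theorem measurable_excur (n : ℕ) :
    Measurable fun p : (ℕ → ℕ → ℝ) × (ℕ → ℕ → ℝ) => excur n p.1 p.2 := by
  induction n with
  | zero => exact measurable_const
  | succ n ih =>
    have h1 : Measurable fun p : (ℕ → ℕ → ℝ) × (ℕ → ℕ → ℝ) => (p.1 0, p.2 0) :=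
      ((measurable_pi_apply 0).comp measurable_fst).prodMk
        ((measurable_pi_apply 0).comp measurable_snd)
    have h2 := (ih.comp measurable_shift_prod).add_const 1
    exact measurable_leftsBefore.comp (h1.prodMk h2)

theorem measurable_excurSup :
    Measurable fun p : (ℕ → ℕ → ℝ) × (ℕ → ℕ → ℝ) => excurSup p.1 p.2 :=
  Measurable.iSup measurable_excur

theorem measurable_excur_right (n : ℕ) (e : ℕ → ℕ → ℝ) : Measurable fun u => excur n e u :=
  (measurable_excur n).comp (measurable_const.prodMk measurable_id)

theorem measurable_excurSup_right (e : ℕ → ℕ → ℝ) : Measurable fun u => excurSup e u :=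
  measurable_excurSup.comp (measurable_const.prodMk measurable_id)

theorem excur_le_succ (n : ℕ) (e u : ℕ → ℕ → ℝ) : excur n e u ≤ excur (n + 1) e u := by
  induction n generalizing e u with
  | zero => exact zero_le
  | succ n ih => exact leftsBefore_mono _ _ (by gcongr; exact ih _ _)

theorem excur_mono (e u : ℕ → ℕ → ℝ) : Monotone fun n => excur n e u :=
  monotone_nat_of_le_succ fun n => excur_le_succ n e u

theorem excur_le_excurSup (n : ℕ) (e u : ℕ → ℕ → ℝ) : excur n e u ≤ excurSup e u :=
  le_iSup (fun n => excur n e u) n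

theorem excur_mem_range (n : ℕ) (e u : ℕ → ℕ → ℝ) :
    excur n e u ∈ range (fun k : ℕ∞ => (k : ℝ≥0∞)) := by
  cases n with
  | zero => exact ⟨0, by simp [excur]⟩
  | succ n => exact leftsBefore_mem_range _ _ _

theorem excur_add_one_mem_range (n : ℕ) (e u : ℕ → ℕ → ℝ) :
    excur n e u + 1 ∈ range (fun k : ℕ∞ => (k : ℝ≥0∞)) := by
  obtain ⟨k, hk⟩ := excur_mem_range n e u
  exact ⟨k + 1, by simp only [← hk]; simp⟩

theorem excurSup_le (e u : ℕ → ℕ → ℝ) :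
    excurSup e u ≤ leftsBefore (e 0) (u 0) (excurSup (shiftSeq e) (shiftSeq u) + 1) := by
  refine iSup_le fun n => ?_
  cases n with
  | zero => exact zero_le
  | succ n => exact leftsBefore_mono _ _ (by gcongr; exact excur_le_excurSup _ _ _)

theorem excurSup_shift_eq_top {e u : ℕ → ℕ → ℝ} (h : InfRight (e 0) (u 0))
    (htop : excurSup e u = ⊤) : excurSup (shiftSeq e) (shiftSeq u) = ⊤ := by
  by_contra hne
  refine leftsBefore_ne_top h (ENNReal.add_ne_top.2 ⟨hne, ENNReal.one_ne_top⟩)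
    (top_le_iff.1 (htop ▸ excurSup_le e u))

theorem measurePreserving_shift_fieldLaw : MeasurePreserving shiftSeq fieldLaw fieldLaw :=
  measurePreserving_reindex_infinitePi siteLaw (g := fun n : ℕ => n + 1)
    (add_left_injective 1)

/-- Under `fieldLaw` the variables at the site `0` are independent of the other ones. -/
theorem lintegral_fieldLaw_cons {Φ : (ℕ → ℝ) → (ℕ → ℕ → ℝ) → ℝ≥0∞}
    (hΦ : Measurable fun p : (ℕ → ℝ) × (ℕ → ℕ → ℝ) => Φ p.1 p.2) :
    ∫⁻ u, Φ (u 0) (shiftSeq u) ∂fieldLaw = ∫⁻ u, ∫⁻ v, Φ v u ∂siteLaw ∂fieldLaw := by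
  have hm : Measurable fun u : ℕ → ℕ → ℝ => Φ (u 0) (shiftSeq u) :=
    hΦ.comp ((measurable_pi_apply 0).prodMk measurable_shiftSeq)
  have hs : ∀ (u : ℕ → ℕ → ℝ) v, shiftSeq (Function.update u 0 v) = shiftSeq u := fun u v => by
    funext n; simp [shiftSeq]
  rw [fieldLaw, lintegral_infinitePi_update siteLaw 0 hm]
  simp only [Function.update_self, hs]
  exact measurePreserving_shift_fieldLaw.lintegral_comp
    (f := fun u => ∫⁻ v, Φ v u ∂siteLaw) (hΦ.lintegral_prod_left')

/-- All cookie strengths on the nonnegative sites lie in `[1/2, 1]`. -/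
def IsHalfEnv (e : ℕ → ℕ → ℝ) : Prop := ∀ j i, e j i ∈ Set.Icc (1/2 : ℝ) 1

theorem IsHalfEnv.shift {e : ℕ → ℕ → ℝ} (h : IsHalfEnv e) : IsHalfEnv (shiftSeq e) :=
  fun j i => h (j + 1) i

theorem measurable_leftsBefore_excur (c : ℕ → ℝ) (n : ℕ) (e : ℕ → ℕ → ℝ) :
    Measurable fun p : (ℕ → ℝ) × (ℕ → ℕ → ℝ) => leftsBefore c p.1 (excur n e p.2 + 1) :=
  measurable_leftsBefore.comp ((measurable_const.prodMk measurable_fst).prodMk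
    (((measurable_excur_right n e).comp measurable_snd).add_const 1))

theorem measurable_driftBefore_excur (c : ℕ → ℝ) (n : ℕ) (e : ℕ → ℕ → ℝ) :
    Measurable fun p : (ℕ → ℝ) × (ℕ → ℕ → ℝ) => driftBefore c p.1 (excur n e p.2 + 1) :=
  measurable_driftBefore.comp ((measurable_const.prodMk measurable_fst).prodMk
    (((measurable_excur_right n e).comp measurable_snd).add_const 1))

theorem lintegral_excur_succ {e : ℕ → ℕ → ℝ} (he : IsHalfEnv e) (n : ℕ) :
    ∫⁻ u, excur (n + 1) e u ∂fieldLaw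
      + ∫⁻ u, driftBefore (e 0) (u 0) (excur n (shiftSeq e) (shiftSeq u) + 1) ∂fieldLaw
      = ∫⁻ u, excur n (shiftSeq e) u ∂fieldLaw + 1 := by
  have h1 := lintegral_fieldLaw_cons
    (Φ := fun v u => leftsBefore (e 0) v (excur n (shiftSeq e) u + 1))
    (measurable_leftsBefore_excur (e 0) n (shiftSeq e))
  have h2 := lintegral_fieldLaw_cons
    (Φ := fun v u => driftBefore (e 0) v (excur n (shiftSeq e) u + 1))
    (measurable_driftBefore_excur (e 0) n (shiftSeq e))
  simp only [excur]
  rw [h1, h2, ← lintegral_add_left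
    (measurable_leftsBefore_excur (e 0) n (shiftSeq e)).lintegral_prod_left']
  simp only [lintegral_leftsBefore_add (he 0) (excur_add_one_mem_range _ _ _)]
  rw [lintegral_add_right _ measurable_const]
  simp

theorem lintegral_excur_le {e : ℕ → ℕ → ℝ} (he : IsHalfEnv e) (n : ℕ) :
    ∫⁻ u, excur n e u ∂fieldLaw ≤ n := by
  induction n generalizing e with
  | zero => simp [excur]
  | succ n ih =>
    calc _ ≤ _ := le_self_add
      _ = _ := lintegral_excur_succ he n
      _ ≤ (n : ℝ≥0∞) + 1 := by gcongr; exact ih he.shift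
      _ = _ := by push_cast; rfl

theorem lintegral_excur_sq_le {e : ℕ → ℕ → ℝ} (he : IsHalfEnv e) (n : ℕ) :
    ∫⁻ u, excur n e u ^ 2 ∂fieldLaw ≤ 2 * (n : ℝ≥0∞) ^ 2 + n := by
  induction n generalizing e with
  | zero => simp [excur]
  | succ n ih =>
    have h1 := lintegral_fieldLaw_cons
      (Φ := fun v u => leftsBefore (e 0) v (excur n (shiftSeq e) u + 1) ^ 2)
      ((measurable_leftsBefore_excur (e 0) n (shiftSeq e)).pow_const 2)
    have hm := measurable_excur_right n (shiftSeq e)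
    simp only [excur]
    rw [h1]
    calc _ ≤ ∫⁻ u, (excur n (shiftSeq e) u ^ 2 + (4 * excur n (shiftSeq e) u + 3)) ∂fieldLaw := by
          refine lintegral_mono fun u => ?_
          refine (lintegral_leftsBefore_sq_le (he 0) (excur_add_one_mem_range _ _ _)).trans
            (le_of_eq ?_)
          ring
      _ = ∫⁻ u, excur n (shiftSeq e) u ^ 2 ∂fieldLaw
          + (4 * ∫⁻ u, excur n (shiftSeq e) u ∂fieldLaw + 3) := by
          rw [lintegral_add_left (hm.pow_const 2), lintegral_add_right _ measurable_const,
            lintegral_const_mul _ hm]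
          simp
      _ ≤ (2 * (n : ℝ≥0∞) ^ 2 + n) + (4 * n + 3) := by
          gcongr
          · exact ih he.shift
          · exact lintegral_excur_le he.shift n
      _ = _ := by push_cast; ring

theorem ae_infRight_field {e : ℕ → ℕ → ℝ} (he : IsHalfEnv e) :
    ∀ᵐ u ∂fieldLaw, ∀ j, InfRight (e j) (u j) := by
  refine ae_all_iff.2 fun j => ?_
  exact (measurePreserving_eval_infinitePi (fun _ : ℕ => siteLaw) j).quasiMeasurePreserving.ae
    (ae_infRight (he j))

theorem fieldLaw_cons {A : Set (ℕ → ℝ)} {B : Set (ℕ → ℕ → ℝ)} (hA : MeasurableSet A)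
    (hB : MeasurableSet B) :
    fieldLaw {u | u 0 ∈ A ∧ shiftSeq u ∈ B} = siteLaw A * fieldLaw B := by
  have hind : Measurable fun p : (ℕ → ℝ) × (ℕ → ℕ → ℝ) =>
      A.indicator (1 : (ℕ → ℝ) → ℝ≥0∞) p.1 * B.indicator (1 : (ℕ → ℕ → ℝ) → ℝ≥0∞) p.2 :=
    ((measurable_one.indicator hA).comp measurable_fst).mul
      ((measurable_one.indicator hB).comp measurable_snd)
  have h := lintegral_fieldLaw_cons
    (Φ := fun v u => A.indicator (1 : (ℕ → ℝ) → ℝ≥0∞) v * B.indicator (1 : (ℕ → ℕ → ℝ) → ℝ≥0∞) u)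
    hind
  have hS : MeasurableSet {u : ℕ → ℕ → ℝ | u 0 ∈ A ∧ shiftSeq u ∈ B} :=
    (measurable_pi_apply 0 hA).inter (measurable_shiftSeq hB)
  rw [← lintegral_indicator_one hS]
  calc _ = ∫⁻ u, A.indicator (1 : (ℕ → ℝ) → ℝ≥0∞) (u 0)
        * B.indicator (1 : (ℕ → ℕ → ℝ) → ℝ≥0∞) (shiftSeq u) ∂fieldLaw := by
        refine lintegral_congr fun u => ?_
        by_cases h1 : u 0 ∈ A <;> by_cases h2 : shiftSeq u ∈ B <;> simp [h1, h2, Set.indicator]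
    _ = _ := h
    _ = _ := by
        have : ∀ u : ℕ → ℕ → ℝ, ∫⁻ v, A.indicator (1 : (ℕ → ℝ) → ℝ≥0∞) v
            * B.indicator (1 : (ℕ → ℕ → ℝ) → ℝ≥0∞) u ∂siteLaw
            = siteLaw A * B.indicator (1 : (ℕ → ℕ → ℝ) → ℝ≥0∞) u := fun u => by
          rw [lintegral_mul_const _ (measurable_one.indicator hA), lintegral_indicator_one hA]
        simp only [this]
        rw [lintegral_const_mul _ (measurable_one.indicator hB), lintegral_indicator_one hB]

/-- The drift consumed at the site `0` by the excursion walk, up to its first passage at `n`. -/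
def excurDrift (n : ℕ) (e u : ℕ → ℕ → ℝ) : ℝ≥0∞ :=
  driftBefore (e 0) (u 0) (excur n (shiftSeq e) (shiftSeq u) + 1)

/-- The total drift consumed at the site `0` by the excursion walk. -/
def excurSupDrift (e u : ℕ → ℕ → ℝ) : ℝ≥0∞ :=
  driftBefore (e 0) (u 0) (excurSup (shiftSeq e) (shiftSeq u) + 1)

theorem measurable_siteZero : Measurable fun p : (ℕ → ℕ → ℝ) × (ℕ → ℕ → ℝ) => (p.1 0, p.2 0) :=
  ((measurable_pi_apply 0).comp measurable_fst).prodMk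
    ((measurable_pi_apply 0).comp measurable_snd)

theorem measurable_excurDrift (n : ℕ) :
    Measurable fun p : (ℕ → ℕ → ℝ) × (ℕ → ℕ → ℝ) => excurDrift n p.1 p.2 :=
  measurable_driftBefore.comp (measurable_siteZero.prodMk
    (((measurable_excur n).comp measurable_shift_prod).add_const 1))

theorem excurDrift_mono (e u : ℕ → ℕ → ℝ) : Monotone fun n => excurDrift n e u := fun _ _ h =>
  driftBefore_mono _ _ (by gcongr; exact excur_mono _ _ h)

theorem excurDrift_le (n : ℕ) (e u : ℕ → ℕ → ℝ) : excurDrift n e u ≤ excurSupDrift e u :=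
  driftBefore_mono _ _ (by gcongr; exact excur_le_excurSup _ _ _)

/-- The total drift stored at one site. -/
def siteDrift (c : ℕ → ℝ) : ℝ≥0∞ := ∑' i, ENNReal.ofReal (2 * c i - 1)

theorem measurable_siteDrift : Measurable siteDrift := by
  unfold siteDrift
  exact Measurable.tsum fun i => by fun_prop

theorem siteDrift_le_iSup {e u : ℕ → ℕ → ℝ} (h : excurSup (shiftSeq e) (shiftSeq u) = ⊤) :
    siteDrift (e 0) ≤ ⨆ n, excurDrift n e u := by
  rw [siteDrift, ENNReal.tsum_eq_iSup_nat]
  refine iSup_le fun I => ?_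
  have : (I : ℝ≥0∞) < ⨆ n, excur n (shiftSeq e) (shiftSeq u) := by
    change _ < excurSup _ _
    rw [h]; exact ENNReal.natCast_lt_top I
  obtain ⟨n, hn⟩ := lt_iSup_iff.1 this
  refine le_iSup_of_le n ?_
  unfold excurDrift driftBefore
  refine le_trans (Finset.sum_le_sum fun i hi => ?_) (ENNReal.sum_le_tsum (Finset.range I))
  rw [if_pos]
  calc (nRight (e 0) (u 0) i : ℝ≥0∞) ≤ i := by exact_mod_cast nRight_le _ _ _
    _ ≤ I := by exact_mod_cast (Finset.mem_range.1 hi).le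
    _ < _ := hn
    _ ≤ _ := le_self_add

section Annealed

variable {μ : Measure (ℕ → ℕ → ℝ)} [IsProbabilityMeasure μ]

theorem measurePreserving_shift_joint (hs : MeasurePreserving shiftSeq μ μ) :
    MeasurePreserving (Prod.map shiftSeq shiftSeq) (μ.prod fieldLaw) (μ.prod fieldLaw) :=
  hs.prod measurePreserving_shift_fieldLaw

theorem lintegral_joint_excur_le (he : ∀ᵐ e ∂μ, IsHalfEnv e) (n : ℕ) :
    ∫⁻ p, excur n p.1 p.2 ∂(μ.prod fieldLaw) ≤ n := by
  rw [lintegral_prod _ (measurable_excur n).aemeasurable]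
  calc _ ≤ ∫⁻ _, (n : ℝ≥0∞) ∂μ := lintegral_mono_ae (he.mono fun e h => lintegral_excur_le h n)
    _ = n := by simp

theorem lintegral_joint_excur_sq_le (he : ∀ᵐ e ∂μ, IsHalfEnv e) (n : ℕ) :
    ∫⁻ p, excur n p.1 p.2 ^ 2 ∂(μ.prod fieldLaw) ≤ 2 * (n : ℝ≥0∞) ^ 2 + n := by
  rw [lintegral_prod _ ((measurable_excur n).pow_const 2).aemeasurable]
  calc _ ≤ ∫⁻ _, (2 * (n : ℝ≥0∞) ^ 2 + n) ∂μ :=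
        lintegral_mono_ae (he.mono fun e h => lintegral_excur_sq_le h n)
    _ = _ := by simp

theorem lintegral_joint_excur_succ (hs : MeasurePreserving shiftSeq μ μ)
    (he : ∀ᵐ e ∂μ, IsHalfEnv e) (n : ℕ) :
    ∫⁻ p, excur (n + 1) p.1 p.2 ∂(μ.prod fieldLaw)
      + ∫⁻ p, excurDrift n p.1 p.2 ∂(μ.prod fieldLaw)
      = ∫⁻ p, excur n p.1 p.2 ∂(μ.prod fieldLaw) + 1 := by
  rw [lintegral_prod _ (measurable_excur _).aemeasurable,
    lintegral_prod _ (measurable_excurDrift _).aemeasurable,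
    lintegral_prod _ (measurable_excur _).aemeasurable,
    ← lintegral_add_left (measurable_excur (n + 1)).lintegral_prod_right']
  have h1 : ∫⁻ e, ∫⁻ u, excur n (shiftSeq e) u ∂fieldLaw ∂μ
      = ∫⁻ e, ∫⁻ u, excur n e u ∂fieldLaw ∂μ :=
    hs.lintegral_comp (f := fun e => ∫⁻ u, excur n e u ∂fieldLaw)
      (measurable_excur n).lintegral_prod_right'
  rw [← h1]
  calc _ = ∫⁻ e, (∫⁻ u, excur n (shiftSeq e) u ∂fieldLaw + 1) ∂μ :=
        lintegral_congr_ae (he.mono fun e h => lintegral_excur_succ h n)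
    _ = _ := by rw [lintegral_add_right _ measurable_const]; simp

theorem lintegral_joint_excurDrift_le_one (hs : MeasurePreserving shiftSeq μ μ)
    (he : ∀ᵐ e ∂μ, IsHalfEnv e) (n : ℕ) :
    ∫⁻ p, excurDrift n p.1 p.2 ∂(μ.prod fieldLaw) ≤ 1 := by
  have h1 := lintegral_joint_excur_succ hs he n
  have h2 : ∫⁻ p, excur n p.1 p.2 ∂(μ.prod fieldLaw)
      ≤ ∫⁻ p, excur (n + 1) p.1 p.2 ∂(μ.prod fieldLaw) :=
    lintegral_mono fun p => excur_le_succ n p.1 p.2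
  have h3 : ∫⁻ p, excur n p.1 p.2 ∂(μ.prod fieldLaw) ≠ ⊤ :=
    ((lintegral_joint_excur_le he n).trans_lt (ENNReal.natCast_lt_top n)).ne
  refine (ENNReal.add_le_add_iff_left h3).1 ?_
  rw [← h1]
  gcongr

theorem le_lintegral_joint_excur (hs : MeasurePreserving shiftSeq μ μ)
    (he : ∀ᵐ e ∂μ, IsHalfEnv e) (n : ℕ) :
    (n : ℝ≥0∞) ≤ ∫⁻ p, excur n p.1 p.2 ∂(μ.prod fieldLaw)
      + n * ∫⁻ p, excurSupDrift p.1 p.2 ∂(μ.prod fieldLaw) := by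
  induction n with
  | zero => simp
  | succ n ih =>
    have h1 := lintegral_joint_excur_succ hs he n
    set D := ∫⁻ p, excurSupDrift p.1 p.2 ∂(μ.prod fieldLaw)
    have h2 : ∫⁻ p, excurDrift n p.1 p.2 ∂(μ.prod fieldLaw) ≤ D :=
      lintegral_mono fun p => excurDrift_le n p.1 p.2
    calc ((n + 1 : ℕ) : ℝ≥0∞) = n + 1 := by push_cast; rfl
      _ ≤ (∫⁻ p, excur n p.1 p.2 ∂(μ.prod fieldLaw) + n * D) + 1 := by gcongr
      _ = (∫⁻ p, excur n p.1 p.2 ∂(μ.prod fieldLaw) + 1) + n * D := by ring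
      _ ≤ (∫⁻ p, excur (n + 1) p.1 p.2 ∂(μ.prod fieldLaw) + D) + n * D := by
          rw [← h1]; gcongr
      _ = _ := by push_cast; ring

/-- If the excursion walk steps infinitely often to the left then the mean drift is at most `1`. -/
theorem lintegral_siteDrift_le_one (hs : MeasurePreserving shiftSeq μ μ)
    (he : ∀ᵐ e ∂μ, IsHalfEnv e) (htop : ∀ᵐ p ∂(μ.prod fieldLaw), excurSup p.1 p.2 = ⊤) :
    ∫⁻ e, siteDrift (e 0) ∂μ ≤ 1 := by
  have hm : Measurable fun e : ℕ → ℕ → ℝ => siteDrift (e 0) :=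
    measurable_siteDrift.comp (measurable_pi_apply 0)
  have h1 : ∫⁻ e, siteDrift (e 0) ∂μ = ∫⁻ p, siteDrift (p.1 0) ∂(μ.prod fieldLaw) := by
    exact (measurePreserving_fst (μ := μ) (ν := fieldLaw)).lintegral_comp hm |>.symm
  have h2 := (measurePreserving_shift_joint hs).quasiMeasurePreserving.ae htop
  calc _ = _ := h1
    _ ≤ ∫⁻ p, ⨆ n, excurDrift n p.1 p.2 ∂(μ.prod fieldLaw) :=
        lintegral_mono_ae (h2.mono fun p hp => siteDrift_le_iSup hp)
    _ = ⨆ n, ∫⁻ p, excurDrift n p.1 p.2 ∂(μ.prod fieldLaw) :=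
        lintegral_iSup measurable_excurDrift fun _ _ h p => excurDrift_mono p.1 p.2 h
    _ ≤ 1 := iSup_le fun n => lintegral_joint_excurDrift_le_one hs he n

theorem exists_measure_excurSup_gt_le (hfin : ∀ᵐ p ∂(μ.prod fieldLaw), excurSup p.1 p.2 < ⊤)
    {t : ℝ≥0∞} (ht : t ≠ 0) :
    ∃ K : ℕ, (μ.prod fieldLaw) {p | (K : ℝ≥0∞) < excurSup p.1 p.2} ≤ t := by
  have hm : ∀ K : ℕ, MeasurableSet {p : (ℕ → ℕ → ℝ) × (ℕ → ℕ → ℝ) |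
      (K : ℝ≥0∞) < excurSup p.1 p.2} := fun K => measurableSet_lt measurable_const measurable_excurSup
  have h := tendsto_measure_iInter_atTop (μ := μ.prod fieldLaw)
    (s := fun K : ℕ => {p : (ℕ → ℕ → ℝ) × (ℕ → ℕ → ℝ) | (K : ℝ≥0∞) < excurSup p.1 p.2})
    (fun K => (hm K).nullMeasurableSet)
    (fun a b hab p (hp : (b : ℝ≥0∞) < excurSup p.1 p.2) =>
      show (a : ℝ≥0∞) < excurSup p.1 p.2 from lt_of_le_of_lt (by exact_mod_cast hab) hp)
    ⟨0, measure_ne_top _ _⟩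
  have h0 : (μ.prod fieldLaw) (⋂ K : ℕ, {p | (K : ℝ≥0∞) < excurSup p.1 p.2}) = 0 := by
    refine measure_mono_null (fun p hp => ?_) (ae_iff.1 hfin)
    rw [Set.mem_ofPred_eq]
    intro hlt
    obtain ⟨K, hK⟩ := ENNReal.exists_nat_gt hlt.ne
    exact absurd (Set.mem_iInter.1 hp K) (not_lt.2 hK.le)
  rw [h0] at h
  obtain ⟨K, hK⟩ := ((tendsto_order.1 h).2 t (pos_iff_ne_zero.2 ht)).exists
  exact ⟨K, hK.le⟩

theorem lintegral_joint_excur_truncated (he : ∀ᵐ e ∂μ, IsHalfEnv e) {t : ℝ≥0∞} {K : ℕ}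
    (hK : (μ.prod fieldLaw) {p | (K : ℝ≥0∞) < excurSup p.1 p.2} ≤ t ^ 2) (n : ℕ) :
    n * t * ∫⁻ p, excur n p.1 p.2 ∂(μ.prod fieldLaw)
      ≤ n * t * K + t ^ 2 * (2 * (n : ℝ≥0∞) ^ 2 + n) + n ^ 2 * t ^ 2 := by
  set M := μ.prod fieldLaw
  have hB : MeasurableSet {p : (ℕ → ℕ → ℝ) × (ℕ → ℕ → ℝ) |
      (K : ℝ≥0∞) < excurSup p.1 p.2} := measurableSet_lt measurable_const measurable_excurSup
  set B := {p : (ℕ → ℕ → ℝ) × (ℕ → ℕ → ℝ) | (K : ℝ≥0∞) < excurSup p.1 p.2}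
  rw [← lintegral_const_mul _ (measurable_excur n)]
  calc _ ≤ ∫⁻ p, (n * t * K + t ^ 2 * excur n p.1 p.2 ^ 2
        + n ^ 2 * B.indicator (1 : (ℕ → ℕ → ℝ) × (ℕ → ℕ → ℝ) → ℝ≥0∞) p) ∂M := by
        refine lintegral_mono fun p => ?_
        by_cases hp : p ∈ B
        · simp only [Set.indicator_of_mem hp, Pi.one_apply, mul_one]
          rcases le_total (t * excur n p.1 p.2) n with h | h
          · calc n * t * excur n p.1 p.2 = n * (t * excur n p.1 p.2) := by ring
              _ ≤ n * n := by gcongr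
              _ = (n : ℝ≥0∞) ^ 2 := by ring
              _ ≤ _ := le_add_self
          · calc n * t * excur n p.1 p.2 = n * (t * excur n p.1 p.2) := by ring
              _ ≤ (t * excur n p.1 p.2) * (t * excur n p.1 p.2) := by gcongr
              _ = t ^ 2 * excur n p.1 p.2 ^ 2 := by ring
              _ ≤ _ := le_add_self
              _ ≤ _ := le_self_add
        · have : excur n p.1 p.2 ≤ K := (excur_le_excurSup n _ _).trans (not_lt.1 hp)
          calc n * t * excur n p.1 p.2 ≤ n * t * K := by gcongr
            _ ≤ _ := le_self_add
            _ ≤ _ := le_self_add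
    _ = n * t * K + t ^ 2 * ∫⁻ p, excur n p.1 p.2 ^ 2 ∂M + n ^ 2 * M B := by
        rw [lintegral_add_right _ ((measurable_one.indicator hB).const_mul _),
          lintegral_add_left measurable_const,
          lintegral_const_mul _ ((measurable_excur n).pow_const 2),
          lintegral_const_mul _ (measurable_one.indicator hB), lintegral_indicator_one hB]
        simp
    _ ≤ _ := by
        gcongr
        exact lintegral_joint_excur_sq_le he n

/-- If the excursion walk is transient, it consumes a mean drift of at least `1` per site. -/
theorem one_le_lintegral_excurSupDrift (hs : MeasurePreserving shiftSeq μ μ)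
    (he : ∀ᵐ e ∂μ, IsHalfEnv e) (hfin : ∀ᵐ p ∂(μ.prod fieldLaw), excurSup p.1 p.2 < ⊤) :
    1 ≤ ∫⁻ p, excurSupDrift p.1 p.2 ∂(μ.prod fieldLaw) := by
  by_contra! hlt
  have hle := le_lintegral_joint_excur hs he
  generalize ∫⁻ p, excurSupDrift p.1 p.2 ∂(μ.prod fieldLaw) = D at hlt hle
  lift D to NNReal using (hlt.trans ENNReal.one_lt_top).ne
  have hD : (D : ℝ) < 1 := by exact_mod_cast hlt
  let t : NNReal := ⟨(1 - D) / 8, by linarith⟩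
  have htr : (t : ℝ) = (1 - D) / 8 := rfl
  have ht : 0 < (t : ℝ) := by rw [htr]; linarith
  have ht0 : (t : ℝ≥0∞) ≠ 0 := by
    have : 0 < t := by exact_mod_cast ht
    exact_mod_cast this.ne'
  obtain ⟨K, hK⟩ := exists_measure_excurSup_gt_le hfin (pow_ne_zero 2 ht0)
  obtain ⟨n, hn⟩ := exists_nat_gt (2 * K / (1 - D) : ℝ)
  rw [div_lt_iff₀ (by linarith)] at hn
  have h1 := lintegral_joint_excur_truncated he hK n
  have h2 : (n : ℝ≥0∞) * t * n ≤ n * t * K + t ^ 2 * (2 * (n : ℝ≥0∞) ^ 2 + n) + n ^ 2 * t ^ 2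
      + n * t * (n * D) := by
    calc (n : ℝ≥0∞) * t * n ≤ n * t * _ := by gcongr; exact hle n
      _ = _ := mul_add _ _ _
      _ ≤ _ := by gcongr
  have h3 : (n : ℝ) * t * n ≤ n * t * K + t ^ 2 * (2 * (n : ℝ) ^ 2 + n) + n ^ 2 * t ^ 2
      + n * t * (n * D) := by exact_mod_cast h2
  have hn0 : (1 : ℝ) ≤ n := by
    rcases Nat.eq_zero_or_pos n with rfl | h
    · have : (0 : ℝ) ≤ K := Nat.cast_nonneg K
      simp at hn; linarith
    · exact_mod_cast h
  have h4 : (t : ℝ) ^ 2 * n ≤ t ^ 2 * n ^ 2 := by gcongr; nlinarith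
  have h5 : (n : ℝ) * t * n ≤ n * t * (K + 4 * n * t + n * D) := by nlinarith
  have h6 := le_of_mul_le_mul_left h5 (by positivity)
  rw [htr] at h6
  nlinarith

end Annealed

section Degenerate

variable {μ : Measure (ℕ → ℕ → ℝ)} [IsProbabilityMeasure μ]

theorem excurSup_eq_zero {e u : ℕ → ℕ → ℝ} {m : ℕ} (hm : excurSup (shiftSeq e) (shiftSeq u) ≤ m)
    (h : ∀ i < m + 1, u 0 i ≤ e 0 i) : excurSup e u = 0 := by
  refine le_antisymm ((excurSup_le e u).trans (le_of_eq ?_)) zero_le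
  refine leftsBefore_eq_zero h ?_
  push_cast
  gcongr

theorem driftBefore_one {c v : ℕ → ℝ} (h : v 0 ≤ c 0) :
    driftBefore c v 1 = ENNReal.ofReal (2 * c 0 - 1) := by
  unfold driftBefore
  rw [tsum_eq_single 0]
  · simp [nRight]
  · intro i hi
    rw [if_neg]
    have h1 : nRight c v 1 ≤ nRight c v i := nRight_mono c v (Nat.one_le_iff_ne_zero.2 hi)
    have h2 : nRight c v 1 = 1 := by simp [nRight, h]
    rw [h2] at h1
    exact not_lt.2 (by exact_mod_cast h1)

theorem siteDrift_eq_of_ae {e : ℕ → ℕ → ℝ} (he : IsHalfEnv e)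
    (h : ∀ᵐ u ∂fieldLaw, excurSupDrift e u = siteDrift (e 0) ∧
      excurSup (shiftSeq (shiftSeq e)) (shiftSeq (shiftSeq u)) < ⊤) :
    siteDrift (e 0) = ENNReal.ofReal (2 * e 0 0 - 1) := by
  have hmeas : ∀ m : ℕ, MeasurableSet {u | excurSup (shiftSeq (shiftSeq e)) u ≤ m} := fun m =>
    measurableSet_le (measurable_excurSup_right _) measurable_const
  obtain ⟨m, hm⟩ : ∃ m : ℕ, fieldLaw {u | excurSup (shiftSeq (shiftSeq e)) u ≤ m} ≠ 0 := by
    by_contra! h0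
    have h1 : fieldLaw (⋃ m : ℕ, {u | excurSup (shiftSeq (shiftSeq e)) u ≤ m}) = 0 :=
      measure_iUnion_null h0
    have h2 := ((measurePreserving_shift_fieldLaw.comp
      measurePreserving_shift_fieldLaw).quasiMeasurePreserving.ae
        (measure_eq_zero_iff_ae_notMem.1 h1))
    obtain ⟨u, hu1, hu2⟩ := (h.and h2).exists
    obtain ⟨m, hm⟩ := ENNReal.exists_nat_gt hu1.2.ne
    exact hu2 (Set.mem_iUnion.2 ⟨m, hm.le⟩)
  have hA0 := measurableSet_forall_right (e 0) 1
  have hA1 := measurableSet_forall_right (e 1) (m + 1)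
  have hpos : fieldLaw {u | u 0 ∈ {v : ℕ → ℝ | ∀ i < 1, v i ≤ e 0 i} ∧ shiftSeq u ∈
      {u | u 0 ∈ {v : ℕ → ℝ | ∀ i < m + 1, v i ≤ e 1 i} ∧ shiftSeq u ∈
        {u | excurSup (shiftSeq (shiftSeq e)) u ≤ m}}} ≠ 0 := by
    have hB : MeasurableSet {u : ℕ → ℕ → ℝ | u 0 ∈ {v : ℕ → ℝ | ∀ i < m + 1, v i ≤ e 1 i} ∧
        shiftSeq u ∈ {u | excurSup (shiftSeq (shiftSeq e)) u ≤ m}} :=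
      MeasurableSet.inter (s₁ := {u : ℕ → ℕ → ℝ | u 0 ∈ {v : ℕ → ℝ | ∀ i < m + 1, v i ≤ e 1 i}})
        (measurable_pi_apply 0 hA1) (measurable_shiftSeq (hmeas m))
    rw [fieldLaw_cons hA0 hB, fieldLaw_cons hA1 (hmeas m)]
    have hp : ∀ j k, siteLaw {v : ℕ → ℝ | ∀ i < k, v i ≤ e j i} ≠ 0 := fun j k h0 => by
      have := siteLaw_forall_right (he j) k
      rw [h0] at this
      simp at this
    exact mul_ne_zero (hp 0 1) (mul_ne_zero (hp 1 (m + 1)) hm)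
  obtain ⟨u, ⟨hu0, hu1, hu2⟩, hu3⟩ :=
    ((frequently_ae_mem_iff.2 hpos).and_eventually h).exists
  have hz : excurSup (shiftSeq e) (shiftSeq u) = 0 := excurSup_eq_zero hu2 hu1
  rw [← hu3.1, excurSupDrift, hz, zero_add, driftBefore_one (hu0 0 one_pos)]

theorem eq_degenerate_of_siteDrift {c : ℕ → ℝ} (hc : ∀ i, c i ∈ Set.Icc (1/2 : ℝ) 1)
    (h1 : siteDrift c = 1) (h0 : siteDrift c = ENNReal.ofReal (2 * c 0 - 1)) :
    c = fun i => if i = 0 then (1 : ℝ) else 1/2 := by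
  have hz : ∑' i, ENNReal.ofReal (2 * c (i + 1) - 1) = 0 := by
    have h2 : siteDrift c = ENNReal.ofReal (2 * c 0 - 1)
        + ∑' i, ENNReal.ofReal (2 * c (i + 1) - 1) :=
      tsum_eq_zero_add' ENNReal.summable
    rw [← h0] at h2
    have h3 : siteDrift c + 0 = siteDrift c + ∑' i, ENNReal.ofReal (2 * c (i + 1) - 1) := by
      rw [add_zero]; exact h2
    exact ((ENNReal.add_right_inj (by rw [h1]; simp)).1 h3).symm
  rw [ENNReal.tsum_eq_zero] at hz
  funext i
  cases i with
  | zero =>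
    rw [h1] at h0
    have := (ENNReal.ofReal_eq_one).1 h0.symm
    simp; linarith
  | succ i =>
    have := ENNReal.ofReal_eq_zero.1 (hz i)
    have := (hc (i + 1)).1
    simp; linarith

theorem ae_degenerate_of_excurSup_lt_top (hs : MeasurePreserving shiftSeq μ μ)
    (he : ∀ᵐ e ∂μ, IsHalfEnv e) (hfin : ∀ᵐ p ∂(μ.prod fieldLaw), excurSup p.1 p.2 < ⊤)
    (hδ : ∫⁻ e, siteDrift (e 0) ∂μ ≤ 1) :
    ∀ᵐ e ∂μ, e 0 = fun i => if i = 0 then (1 : ℝ) else 1/2 := by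
  have hD := one_le_lintegral_excurSupDrift hs he hfin
  have hm : Measurable fun e : ℕ → ℕ → ℝ => siteDrift (e 0) :=
    measurable_siteDrift.comp (measurable_pi_apply 0)
  have h1 : ∫⁻ p, siteDrift (p.1 0) ∂(μ.prod fieldLaw) = ∫⁻ e, siteDrift (e 0) ∂μ :=
    (measurePreserving_fst (μ := μ) (ν := fieldLaw)).lintegral_comp hm
  have hle : ∀ p : (ℕ → ℕ → ℝ) × (ℕ → ℕ → ℝ), excurSupDrift p.1 p.2 ≤ siteDrift (p.1 0) :=
    fun p => driftBefore_le _ _ _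
  have h2 : ∫⁻ p, excurSupDrift p.1 p.2 ∂(μ.prod fieldLaw)
      ≤ ∫⁻ p, siteDrift (p.1 0) ∂(μ.prod fieldLaw) := lintegral_mono hle
  have h3 := ae_eq_of_ae_le_of_lintegral_le (Eventually.of_forall hle)
    ((h2.trans (h1.le.trans hδ)).trans_lt ENNReal.one_lt_top).ne
    (hm.comp measurable_fst).aemeasurable ((h1.le.trans hδ).trans hD)
  have hj := (measurePreserving_shift_joint hs).quasiMeasurePreserving.ae
    ((measurePreserving_shift_joint hs).quasiMeasurePreserving.ae hfin)
  have h4 := Measure.ae_ae_of_ae_prod (h3.and hj)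
  have h5 : ∀ᵐ e ∂μ, siteDrift (e 0) = ENNReal.ofReal (2 * e 0 0 - 1) := by
    filter_upwards [h4, he] with e h h'
    exact siteDrift_eq_of_ae h' h
  have hEq : ∫⁻ e, siteDrift (e 0) ∂μ = 1 := le_antisymm hδ (hD.trans (h2.trans h1.le))
  have h6 : ∀ᵐ e ∂μ, siteDrift (e 0) ≤ 1 := by
    filter_upwards [h5, he] with e h h'
    rw [h]
    exact ENNReal.ofReal_le_one.2 (by linarith [(h' 0 0).2])
  have h7 := ae_eq_of_ae_le_of_lintegral_le h6 (by rw [hEq]; simp) aemeasurable_const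
    (by rw [hEq]; simp)
  filter_upwards [h5, h7, he] with e h hd hh
  exact eq_degenerate_of_siteDrift (hh 0) hd h

end Degenerate

section ZeroOne

theorem measurable_shiftSeq_iterate {α : Type*} [MeasurableSpace α] (n : ℕ) :
    Measurable (shiftSeq^[n] : (ℕ → α) → ℕ → α) :=
  measurable_shiftSeq.iterate n

theorem shiftSeq_iterate_apply {α : Type*} (n : ℕ) (u : ℕ → α) (j : ℕ) :
    shiftSeq^[n] u j = u (j + n) := by
  induction n generalizing u with
  | zero => rfl
  | succ n ih => rw [Function.iterate_succ_apply, ih, shiftSeq, Nat.add_assoc]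

/-- Kolmogorov's zero-one law for `fieldLaw`. -/
theorem fieldLaw_tail {S : Set (ℕ → ℕ → ℝ)} (B : ℕ → Set (ℕ → ℕ → ℝ))
    (hB : ∀ n, MeasurableSet (B n)) (h : ∀ n, S = shiftSeq^[n] ⁻¹' B n) :
    fieldLaw S = 0 ∨ fieldLaw S = 1 := by
  have hind : iIndepFun (fun (i : ℕ) (u : ℕ → ℕ → ℝ) => u i) fieldLaw :=
    iIndepFun_infinitePi (P := fun _ : ℕ => siteLaw) (X := fun _ v => v) fun _ => measurable_id
  refine measure_zero_or_one_of_measurableSet_limsup_atTop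
    (s := fun i : ℕ => MeasurableSpace.comap (fun u : ℕ → ℕ → ℝ => u i) inferInstance)
    (fun n => (measurable_pi_apply n).comap_le) hind ?_
  rw [limsup_eq_iInf_iSup_of_nat, MeasurableSpace.measurableSet_iInf]
  intro n
  rw [h n]
  have hmeas : Measurable[⨆ i, ⨆ (_ : i ≥ n),
      MeasurableSpace.comap (fun u : ℕ → ℕ → ℝ => u i) inferInstance]
      (shiftSeq^[n] : (ℕ → ℕ → ℝ) → ℕ → ℕ → ℝ) := by
    refine (@measurable_pi_iff _ _ _ (_) _ _).2 fun j => ?_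
    have : (fun u : ℕ → ℕ → ℝ => shiftSeq^[n] u j) = fun u => u (j + n) := by
      funext u; exact shiftSeq_iterate_apply n u j
    rw [this]
    refine Measurable.mono (comap_measurable fun u : ℕ → ℕ → ℝ => u (j + n)) ?_ le_rfl
    exact le_iSup₂_of_le (j + n) (Nat.le_add_left n j) le_rfl
  exact hmeas (hB n)

/-- The excursion walks from all distant sites step infinitely often to the left. -/
def EventuallyTop (e u : ℕ → ℕ → ℝ) : Prop :=
  ∃ K, ∀ k ≥ K, excurSup (shiftSeq^[k] e) (shiftSeq^[k] u) = ⊤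

theorem eventuallyTop_shift (e u : ℕ → ℕ → ℝ) (n : ℕ) :
    EventuallyTop (shiftSeq^[n] e) (shiftSeq^[n] u) ↔ EventuallyTop e u := by
  unfold EventuallyTop
  simp only [← Function.iterate_add_apply]
  constructor
  · rintro ⟨K, h⟩
    refine ⟨K + n, fun k hk => ?_⟩
    have := h (k - n) (by omega)
    rwa [Nat.sub_add_cancel (by omega)] at this
  · rintro ⟨K, h⟩
    exact ⟨K, fun k hk => h _ (by omega)⟩

theorem measurableSet_eventuallyTop :
    MeasurableSet {p : (ℕ → ℕ → ℝ) × (ℕ → ℕ → ℝ) | EventuallyTop p.1 p.2} := by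
  have h : ∀ k, MeasurableSet {p : (ℕ → ℕ → ℝ) × (ℕ → ℕ → ℝ) |
      excurSup (shiftSeq^[k] p.1) (shiftSeq^[k] p.2) = ⊤} := fun k =>
    (measurable_excurSup.comp ((measurable_shiftSeq_iterate k).prodMap
      (measurable_shiftSeq_iterate k))) (measurableSet_singleton ⊤)
  have h2 : {p : (ℕ → ℕ → ℝ) × (ℕ → ℕ → ℝ) | EventuallyTop p.1 p.2} = ⋃ K, ⋂ k ≥ K,
      {p : (ℕ → ℕ → ℝ) × (ℕ → ℕ → ℝ) | excurSup (shiftSeq^[k] p.1) (shiftSeq^[k] p.2) = ⊤} := by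
    ext p
    simp only [Set.mem_iUnion, Set.mem_iInter]
    rfl
  rw [h2]
  exact MeasurableSet.iUnion fun K => MeasurableSet.iInter fun k => MeasurableSet.iInter fun _ => h k

variable {μ : Measure (ℕ → ℕ → ℝ)} [IsProbabilityMeasure μ]

theorem ae_eventuallyTop_iff (hs : MeasurePreserving shiftSeq μ μ) (he : ∀ᵐ e ∂μ, IsHalfEnv e) :
    ∀ᵐ p ∂(μ.prod fieldLaw), EventuallyTop p.1 p.2 ↔ excurSup p.1 p.2 = ⊤ := by
  set M := μ.prod fieldLaw
  have hj := measurePreserving_shift_joint hs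
  have hmA : MeasurableSet {p : (ℕ → ℕ → ℝ) × (ℕ → ℕ → ℝ) | excurSup p.1 p.2 = ⊤} :=
    measurable_excurSup (measurableSet_singleton ⊤)
  have hinf : ∀ᵐ p ∂M, InfRight (p.1 0) (p.2 0) := by
    have hmI : MeasurableSet {p : (ℕ → ℕ → ℝ) × (ℕ → ℕ → ℝ) | InfRight (p.1 0) (p.2 0)} := by
      unfold InfRight
      rw [Set.ofPred_forall]
      refine MeasurableSet.iInter fun m => ?_
      rw [Set.ofPred_exists]
      exact MeasurableSet.iUnion fun i => measurableSet_le measurable_const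
        ((measurable_nRight i).comp measurable_siteZero)
    rw [Measure.ae_prod_iff_ae_ae hmI]
    exact he.mono fun e h => (ae_infRight_field h).mono fun u hu => hu 0
  have hle : {p : (ℕ → ℕ → ℝ) × (ℕ → ℕ → ℝ) | excurSup p.1 p.2 = ⊤} ≤ᵐ[M]
      Prod.map shiftSeq shiftSeq ⁻¹' {p | excurSup p.1 p.2 = ⊤} :=
    hinf.mono fun p hp htop => excurSup_shift_eq_top hp htop
  have heq := ae_eq_of_ae_subset_of_measure_ge hle (hj.measure_preimage hmA.nullMeasurableSet).le
    hmA.nullMeasurableSet (measure_ne_top _ _)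
  have hstep : ∀ᵐ p ∂M, excurSup (shiftSeq p.1) (shiftSeq p.2) = ⊤ ↔ excurSup p.1 p.2 = ⊤ :=
    heq.mono fun p hp => (iff_of_eq hp).symm
  have hall : ∀ᵐ p ∂M, ∀ k, excurSup (shiftSeq^[k] p.1) (shiftSeq^[k] p.2) = ⊤
      ↔ excurSup p.1 p.2 = ⊤ := by
    refine ae_all_iff.2 fun k => ?_
    induction k with
    | zero => exact Eventually.of_forall fun p => Iff.rfl
    | succ k ih =>
      have h1 := hj.quasiMeasurePreserving.ae ih
      filter_upwards [h1, hstep] with p hp hp'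
      simp only [Prod.map_fst, Prod.map_snd] at hp
      simp only [Function.iterate_succ_apply]
      exact hp.trans hp'
  refine hall.mono fun p hp => ?_
  simp only [EventuallyTop, hp]
  exact ⟨fun ⟨K, h⟩ => h K le_rfl, fun h => ⟨0, fun _ _ => h⟩⟩

/-- Under an ergodic environment, the excursion walk is either a.s. recurrent or a.s. transient. -/
theorem excurSup_dichotomy (hs : Ergodic shiftSeq μ) (he : ∀ᵐ e ∂μ, IsHalfEnv e) :
    (∀ᵐ p ∂(μ.prod fieldLaw), excurSup p.1 p.2 = ⊤) ∨
      ∀ᵐ p ∂(μ.prod fieldLaw), excurSup p.1 p.2 < ⊤ := by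
  have hmT := measurableSet_eventuallyTop
  have hmsec : ∀ e, MeasurableSet {u | EventuallyTop e u} := fun e =>
    measurable_prodMk_left (x := e) hmT
  let f : (ℕ → ℕ → ℝ) → ℝ≥0∞ := fun e => fieldLaw {u | EventuallyTop e u}
  have hf : Measurable f := measurable_measure_prodMk_left hmT
  have hf01 : ∀ e, f e = 0 ∨ f e = 1 := fun e =>
    fieldLaw_tail (fun n => {u | EventuallyTop (shiftSeq^[n] e) u}) (fun n => hmsec _) fun n => by
      ext u; exact (eventuallyTop_shift e u n).symm
  have hfs : ∀ e, f (shiftSeq e) = f e := fun e => by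
    have h1 := measurePreserving_shift_fieldLaw.measure_preimage
      (hmsec (shiftSeq e)).nullMeasurableSet
    rw [← show _ = f (shiftSeq e) from h1]
    congr 1
    ext u
    exact eventuallyTop_shift e u 1
  have hiff := ae_eventuallyTop_iff hs.toMeasurePreserving he
  have hF : MeasurableSet {e | f e = 1} := hf (measurableSet_singleton 1)
  have hFinv : shiftSeq ⁻¹' {e | f e = 1} = {e | f e = 1} := by
    ext e; change f (shiftSeq e) = 1 ↔ f e = 1; rw [hfs]
  rcases hs.toPreErgodic.ae_mem_or_ae_notMem hF hFinv with h | h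
  · left
    have h1 : ∀ᵐ p ∂(μ.prod fieldLaw), EventuallyTop p.1 p.2 := by
      rw [Measure.ae_prod_iff_ae_ae hmT]
      refine h.mono fun e he1 => ?_
      exact (prob_compl_eq_zero_iff (hmsec e)).2 he1
    filter_upwards [h1, hiff] with p hp hp'
    exact hp'.1 hp
  · right
    have h1 : ∀ᵐ p ∂(μ.prod fieldLaw), ¬ EventuallyTop p.1 p.2 := by
      have hmc : MeasurableSet {p : (ℕ → ℕ → ℝ) × (ℕ → ℕ → ℝ) | ¬ EventuallyTop p.1 p.2} :=
        hmT.compl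
      rw [Measure.ae_prod_iff_ae_ae hmc]
      refine h.mono fun e he1 => ?_
      exact measure_eq_zero_iff_ae_notMem.1 ((hf01 e).resolve_right he1)
    filter_upwards [h1, hiff] with p hp hp'
    exact lt_top_iff_ne_top.2 fun h => hp (hp'.2 h)

end ZeroOne

/-- Iterated numbers of left arrows: `leftIter j e u m` is the number of left arrows at the `j`-th
site that are used, if at each site the left arrows used are those before the `k`-th right arrow,
where `k` is the number of left arrows used at the previous site, starting from `m`. -/
def leftIter : ℕ → (ℕ → ℕ → ℝ) → (ℕ → ℕ → ℝ) → ℝ≥0∞ → ℝ≥0∞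
  | 0, _, _, m => m
  | j + 1, e, u, m => leftIter j (shiftSeq e) (shiftSeq u) (leftsBefore (e 0) (u 0) m)

theorem leftIter_succ (j : ℕ) (e u : ℕ → ℕ → ℝ) (m : ℝ≥0∞) :
    leftIter (j + 1) e u m = leftsBefore (e j) (u j) (leftIter j e u m) := by
  induction j generalizing e u m with
  | zero => rfl
  | succ j ih => rw [leftIter, ih]; rfl

theorem leftsBefore_zero (c v : ℕ → ℝ) : leftsBefore c v 0 = 0 := by simp [leftsBefore]

theorem leftIter_zero (j : ℕ) (e u : ℕ → ℕ → ℝ) : leftIter j e u 0 = 0 := by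
  induction j with
  | zero => rfl
  | succ j ih => rw [leftIter_succ, ih, leftsBefore_zero]

theorem measurable_leftIter (j : ℕ) (e : ℕ → ℕ → ℝ) :
    Measurable fun p : (ℕ → ℕ → ℝ) × ℝ≥0∞ => leftIter j e p.1 p.2 := by
  induction j generalizing e with
  | zero => exact measurable_snd
  | succ j ih =>
    have h0 : Measurable fun p : (ℕ → ℕ → ℝ) × ℝ≥0∞ => (e 0, p.1 0) :=
      measurable_const.prodMk ((measurable_pi_apply 0).comp measurable_fst)
    have h1 : Measurable fun p : (ℕ → ℕ → ℝ) × ℝ≥0∞ => leftsBefore (e 0) (p.1 0) p.2 :=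
      measurable_leftsBefore.comp (h0.prodMk measurable_snd)
    have h2 : Measurable fun p : (ℕ → ℕ → ℝ) × ℝ≥0∞ =>
        (shiftSeq p.1, leftsBefore (e 0) (p.1 0) p.2) :=
      (measurable_shiftSeq.comp measurable_fst).prodMk h1
    exact (ih (shiftSeq e)).comp h2

theorem measurableSet_leftIter_ne (j : ℕ) (e : ℕ → ℕ → ℝ) (m : ℝ≥0∞) :
    MeasurableSet {u | leftIter j e u m ≠ 0} :=
  ((measurable_leftIter j e).comp (measurable_id.prodMk measurable_const))
    (measurableSet_singleton 0).compl

theorem fieldLaw_leftIter_succ (j : ℕ) (e : ℕ → ℕ → ℝ) (m : ℝ≥0∞) :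
    fieldLaw {u | leftIter (j + 1) e u m ≠ 0} =
      ∫⁻ v, fieldLaw {u | leftIter j (shiftSeq e) u (leftsBefore (e 0) v m) ≠ 0} ∂siteLaw := by
  have hS : MeasurableSet {p : (ℕ → ℝ) × (ℕ → ℕ → ℝ) |
      leftIter j (shiftSeq e) p.2 (leftsBefore (e 0) p.1 m) ≠ 0} :=
    ((measurable_leftIter j (shiftSeq e)).comp (measurable_snd.prodMk
      ((measurable_leftsBefore_right (e 0) m).comp measurable_fst)))
        (measurableSet_singleton 0).compl
  set S := {p : (ℕ → ℝ) × (ℕ → ℕ → ℝ) |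
      leftIter j (shiftSeq e) p.2 (leftsBefore (e 0) p.1 m) ≠ 0}
  have hind : Measurable fun p : (ℕ → ℝ) × (ℕ → ℕ → ℝ) =>
      S.indicator (1 : (ℕ → ℝ) × (ℕ → ℕ → ℝ) → ℝ≥0∞) (p.1, p.2) :=
    measurable_one.indicator hS
  have h := lintegral_fieldLaw_cons
    (Φ := fun v u => S.indicator (1 : (ℕ → ℝ) × (ℕ → ℕ → ℝ) → ℝ≥0∞) (v, u)) hind
  rw [← lintegral_indicator_one (measurableSet_leftIter_ne (j + 1) e m)]
  refine (lintegral_congr fun u => ?_).trans (h.trans ?_)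
  · rfl
  · rw [lintegral_lintegral_swap (f := fun u v =>
      S.indicator (1 : (ℕ → ℝ) × (ℕ → ℕ → ℝ) → ℝ≥0∞) (v, u)) (hind.comp measurable_swap).aemeasurable]
    refine lintegral_congr fun v => ?_
    have hm := measurableSet_leftIter_ne j (shiftSeq e) (leftsBefore (e 0) v m)
    rw [← lintegral_indicator_one hm]
    rfl

theorem lintegral_leftsBefore_le {c : ℕ → ℝ} (hc : ∀ i, c i ∈ Set.Icc (1/2 : ℝ) 1) {m : ℝ≥0∞}
    (hm : m ∈ range (fun k : ℕ∞ => (k : ℝ≥0∞))) : ∫⁻ v, leftsBefore c v m ∂siteLaw ≤ m :=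
  le_self_add.trans (lintegral_leftsBefore_add hc hm).le

theorem siteLaw_leftsBefore_ne_zero {c : ℕ → ℝ} (hc : ∀ i, c i ∈ Set.Icc (1/2 : ℝ) 1) {m : ℝ≥0∞}
    {K : ℕ} (hm : m ≤ K) : siteLaw {v | leftsBefore c v m ≠ 0} ≤ 1 - 2⁻¹ ^ K := by
  calc _ ≤ siteLaw {v : ℕ → ℝ | ∀ i < K, v i ≤ c i}ᶜ :=
        measure_mono fun v (hv : leftsBefore c v m ≠ 0) hv' => hv (leftsBefore_eq_zero hv' hm)
    _ = 1 - siteLaw {v : ℕ → ℝ | ∀ i < K, v i ≤ c i} :=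
        prob_compl_eq_one_sub (measurableSet_forall_right c K)
    _ ≤ _ := tsub_le_tsub_left (siteLaw_forall_right hc K) 1

theorem fieldLaw_leftIter_le {e : ℕ → ℕ → ℝ} (he : IsHalfEnv e) {K : ℕ} (hK : K ≠ 0) (j : ℕ)
    {m : ℝ≥0∞} (hm : m ∈ range (fun k : ℕ∞ => (k : ℝ≥0∞))) :
    fieldLaw {u | leftIter j e u m ≠ 0} ≤ m / K + (1 - 2⁻¹ ^ K) ^ j := by
  have hK0 : (K : ℝ≥0∞) ≠ 0 := by exact_mod_cast hK
  induction j generalizing e m with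
  | zero => exact prob_le_one.trans (by simp)
  | succ j ih =>
    rcases le_or_gt (K : ℝ≥0∞) m with h | h
    · refine prob_le_one.trans (le_trans ?_ le_self_add)
      rw [ENNReal.le_div_iff_mul_le (Or.inl hK0) (Or.inl (ENNReal.natCast_ne_top K)), one_mul]
      exact h
    · rw [fieldLaw_leftIter_succ]
      set r : ℝ≥0∞ := 1 - 2⁻¹ ^ K
      have hm1 := measurable_leftsBefore_right (e 0) m
      have hS : MeasurableSet {v | leftsBefore (e 0) v m ≠ 0} :=
        hm1 (measurableSet_singleton 0).compl
      set S := {v | leftsBefore (e 0) v m ≠ 0}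
      calc _ ≤ ∫⁻ v, (leftsBefore (e 0) v m / K
            + r ^ j * S.indicator (1 : (ℕ → ℝ) → ℝ≥0∞) v) ∂siteLaw := by
            refine lintegral_mono fun v => ?_
            by_cases hv : leftsBefore (e 0) v m = 0
            · simp [hv, leftIter_zero]
            · rw [Set.indicator_of_mem (show v ∈ S from hv), Pi.one_apply, mul_one]
              exact ih he.shift (leftsBefore_mem_range _ _ _)
        _ = (∫⁻ v, leftsBefore (e 0) v m ∂siteLaw) / K + r ^ j * siteLaw S := by
            rw [lintegral_add_left (hm1.div_const _),
              lintegral_const_mul _ (measurable_one.indicator hS), lintegral_indicator_one hS]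
            simp only [div_eq_mul_inv]
            rw [lintegral_mul_const _ hm1]
        _ ≤ m / K + r ^ j * r := by
            gcongr
            · exact lintegral_leftsBefore_le (he 0) hm
            · exact siteLaw_leftsBefore_ne_zero (he 0) h.le
        _ = _ := by rw [pow_succ]

/-- The iterated numbers of left arrows die out. -/
theorem ae_exists_leftIter_eq_zero {e : ℕ → ℕ → ℝ} (he : IsHalfEnv e) (m : ℕ) :
    ∀ᵐ u ∂fieldLaw, ∃ j, leftIter j e u m = 0 := by
  have hrange : (m : ℝ≥0∞) ∈ range (fun k : ℕ∞ => (k : ℝ≥0∞)) := ⟨m, by simp⟩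
  have hle : ∀ K : ℕ, K ≠ 0 → fieldLaw {u | ∀ j, leftIter j e u m ≠ 0} ≤ m / K := fun K hK => by
    have h1 : Tendsto (fun j : ℕ => (m : ℝ≥0∞) / K + (1 - 2⁻¹ ^ K) ^ j) atTop
        (𝓝 ((m : ℝ≥0∞) / K + 0)) := by
      refine Tendsto.const_add _ (ENNReal.tendsto_pow_atTop_nhds_zero_of_lt_one ?_)
      refine ENNReal.sub_lt_self ENNReal.one_ne_top one_ne_zero ?_
      exact pow_ne_zero _ (by simp)
    rw [add_zero] at h1
    refine ge_of_tendsto' h1 fun j => ?_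
    exact (measure_mono fun u (hu : ∀ j, leftIter j e u m ≠ 0) => hu j).trans (fieldLaw_leftIter_le he hK j hrange)
  have h0 : fieldLaw {u | ∀ j, leftIter j e u m ≠ 0} = 0 := by
    have h2 : Tendsto (fun K : ℕ => (m : ℝ≥0∞) / K) atTop (𝓝 0) :=
      ENNReal.Tendsto.const_div ENNReal.tendsto_nat_nhds_top (by simp) |>.trans (by simp)
    refine le_antisymm (ge_of_tendsto h2 ?_) zero_le
    filter_upwards [eventually_ne_atTop 0] with K hK using hle K hK
  filter_upwards [measure_eq_zero_iff_ae_notMem.1 h0] with u hu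
  by_contra! h
  exact hu h

section Walk

/-- The position and the local times of the walk from `x` that follows the arrow field in which the
`i`-th arrow at `z` points to the right if and only if `U z i ≤ ω z i`. -/
def walkState (ω U : CEnv) (x : ℤ) : ℕ → ℤ × (ℤ → ℕ)
  | 0 => (x, 0)
  | n + 1 =>
    (if U (walkState ω U x n).1 ((walkState ω U x n).2 (walkState ω U x n).1)
          ≤ ω (walkState ω U x n).1 ((walkState ω U x n).2 (walkState ω U x n).1)
      then (walkState ω U x n).1 + 1 else (walkState ω U x n).1 - 1,
    fun z => (walkState ω U x n).2 z + if (walkState ω U x n).1 = z then 1 else 0)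

/-- The walk from `x` in the arrow field given by `ω` and `U`. -/
def walk (ω U : CEnv) (x : ℤ) (n : ℕ) : ℤ := (walkState ω U x n).1

/-- The number of visits to `z` before time `n`. -/
def visits (ω U : CEnv) (x : ℤ) (n : ℕ) (z : ℤ) : ℕ := (walkState ω U x n).2 z

/-- The number of steps to the right from `z` before time `n`. -/
def numRight (ω U : CEnv) (x : ℤ) (n : ℕ) (z : ℤ) : ℕ := nRight (ω z) (U z) (visits ω U x n z)

/-- The number of steps to the left from `z` before time `n`. -/
def numLeft (ω U : CEnv) (x : ℤ) (n : ℕ) (z : ℤ) : ℕ :=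
  visits ω U x n z - numRight ω U x n z

variable (ω U : CEnv) (x : ℤ)

theorem walk_succ (n : ℕ) :
    walk ω U x (n + 1) =
      if U (walk ω U x n) (visits ω U x n (walk ω U x n))
          ≤ ω (walk ω U x n) (visits ω U x n (walk ω U x n))
      then walk ω U x n + 1 else walk ω U x n - 1 := rfl

theorem visits_succ (n : ℕ) (z : ℤ) :
    visits ω U x (n + 1) z = visits ω U x n z + if walk ω U x n = z then 1 else 0 := rfl

theorem numLeft_add (n : ℕ) (z : ℤ) :
    numLeft ω U x n z + numRight ω U x n z = visits ω U x n z :=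
  Nat.sub_add_cancel (nRight_le _ _ _)

theorem numRight_succ (n : ℕ) (z : ℤ) :
    numRight ω U x (n + 1) z = numRight ω U x n z +
      if walk ω U x n = z ∧ walk ω U x (n + 1) = z + 1 then 1 else 0 := by
  unfold numRight
  rw [visits_succ]
  by_cases h : walk ω U x n = z
  · rw [if_pos h, nRight, walk_succ, h]
    congr 1
    by_cases h2 : U z (visits ω U x n z) ≤ ω z (visits ω U x n z)
    · simp [h2]
    · simp [h2]; omega
  · simp [h]

theorem flow (n : ℕ) (k : ℤ) :
    (if walk ω U x n ≤ k then 1 else 0) + numRight ω U x n k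
      = numLeft ω U x n (k + 1) + if x ≤ k then 1 else 0 := by
  induction n with
  | zero =>
    have h1 : walk ω U x 0 = x := rfl
    simp only [h1]
    simp [numLeft, numRight, visits, walkState, nRight]
  | succ n ih =>
    have h1 := numRight_succ ω U x n k
    have h2 := numRight_succ ω U x n (k + 1)
    have h3 := numLeft_add ω U x n (k + 1)
    have h4 := numLeft_add ω U x (n + 1) (k + 1)
    have h5 := visits_succ ω U x n (k + 1)
    have h6 : walk ω U x (n + 1) = walk ω U x n + 1 ∨ walk ω U x (n + 1) = walk ω U x n - 1 := by
      rw [walk_succ]; split_ifs <;> simp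
    split_ifs at * <;> omega

theorem sum_lefts (c v : ℕ → ℝ) (i : ℕ) :
    ∑ j ∈ Finset.range i, (if ¬ v j ≤ c j then 1 else 0 : ℝ≥0∞) = ((i - nRight c v i : ℕ) : ℝ≥0∞) := by
  induction i with
  | zero => simp [nRight]
  | succ i ih =>
    rw [Finset.sum_range_succ, ih, nRight]
    have := nRight_le c v i
    split_ifs with h
    · rw [add_zero]; congr 1; omega
    · rw [add_zero, Nat.sub_add_comm this]; push_cast; rfl

theorem numLeft_le (n : ℕ) (z : ℤ) :
    (numLeft ω U x n z : ℝ≥0∞) ≤ leftsBefore (ω z) (U z) (numRight ω U x n z + 1) := by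
  rw [numLeft, numRight, ← sum_lefts]
  refine le_trans (Finset.sum_le_sum fun j hj => ?_)
    (ENNReal.sum_le_tsum (Finset.range (visits ω U x n z)))
  have h1 : (nRight (ω z) (U z) j : ℝ≥0∞) < nRight (ω z) (U z) (visits ω U x n z) + 1 := by
    exact_mod_cast Nat.lt_succ_of_le (nRight_mono _ _ (Finset.mem_range.1 hj).le)
  simp [h1]

theorem le_numLeft (n : ℕ) (z : ℤ) :
    leftsBefore (ω z) (U z) (numRight ω U x n z) ≤ numLeft ω U x n z := by
  rw [numLeft, numRight, ← sum_lefts, leftsBefore,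
    tsum_eq_sum (s := Finset.range (visits ω U x n z))]
  · refine Finset.sum_le_sum fun j _ => ?_
    split_ifs <;> first | exact le_rfl | exact zero_le | tauto
  · intro j hj
    rw [if_neg]
    rintro ⟨h, -⟩
    have := nRight_mono (ω z) (U z) (not_lt.1 fun h' => hj (Finset.mem_range.2 h'))
    exact absurd (by exact_mod_cast h) (not_lt.2 this)

theorem visits_mono (z : ℤ) : Monotone fun n => visits ω U x n z :=
  monotone_nat_of_le_succ fun n => by simp [visits_succ]

theorem visits_le (n : ℕ) (z : ℤ) : visits ω U x n z ≤ n := by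
  induction n with
  | zero => simp [visits, walkState]
  | succ n ih => rw [visits_succ]; split_ifs <;> omega

theorem mem_Rset_walk_iff (z : ℤ) :
    walk ω U x ∈ Rset z ↔ ∀ N : ℕ, ∃ n, N ≤ visits ω U x n z := by
  constructor
  · intro h N
    induction N with
    | zero => exact ⟨0, Nat.zero_le _⟩
    | succ N ih =>
      obtain ⟨n, hn⟩ := ih
      obtain ⟨m, hm, hmz⟩ := h n
      refine ⟨m + 1, ?_⟩
      have := visits_mono ω U x z hm
      simp only at this
      rw [visits_succ, if_pos hmz]
      omega
  · intro h N
    by_contra! hN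
    have hb : ∀ n, visits ω U x n z ≤ N := fun n => by
      rcases le_total n N with hn | hn
      · exact (visits_le ω U x n z).trans hn
      · obtain ⟨m, rfl⟩ := Nat.exists_eq_add_of_le hn
        induction m with
        | zero => exact visits_le ω U x N z
        | succ m ih =>
          rw [← Nat.add_assoc, visits_succ, if_neg (hN _ (by omega))]
          exact ih (by omega)
    obtain ⟨n, hn⟩ := h (N + 1)
    have := hb n
    omega

theorem mem_Rset_of_numLeft {z : ℤ} (h : ∀ N : ℕ, ∃ n, N ≤ numLeft ω U x n z) :
    walk ω U x ∈ Rset z :=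
  (mem_Rset_walk_iff ω U x z).2 fun N => (h N).imp fun n hn =>
    hn.trans (by have := numLeft_add ω U x n z; omega)

theorem exists_le_numRight {z : ℤ} (hinf : InfRight (ω z) (U z)) (h : walk ω U x ∈ Rset z)
    (N : ℕ) : ∃ n, N ≤ numRight ω U x n z := by
  obtain ⟨i, hi⟩ := hinf N
  obtain ⟨n, hn⟩ := (mem_Rset_walk_iff ω U x z).1 h i
  exact ⟨n, hi.trans (nRight_mono _ _ hn)⟩

theorem numRight_mono (z : ℤ) : Monotone fun n => numRight ω U x n z :=
  (nRight_mono _ _).comp (visits_mono ω U x z)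

theorem mem_Rset_succ {z : ℤ} (hinf : InfRight (ω z) (U z)) (h : walk ω U x ∈ Rset z) :
    walk ω U x ∈ Rset (z + 1) := by
  refine mem_Rset_of_numLeft ω U x fun N => ?_
  obtain ⟨n, hn⟩ := exists_le_numRight ω U x hinf h (N + 1)
  have := flow ω U x n z
  exact ⟨n, by split_ifs at this <;> omega⟩

theorem mem_Rset_of_le {y z : ℤ} (hinf : ∀ z, InfRight (ω z) (U z)) (h : walk ω U x ∈ Rset y)
    (hyz : y ≤ z) : walk ω U x ∈ Rset z := by
  induction z, hyz using Int.leInduction with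
  | base => exact h
  | succ n _ ih => exact mem_Rset_succ ω U x (hinf n) ih

theorem walk_le (n : ℕ) : walk ω U x n ≤ x + n := by
  induction n with
  | zero => simp [walk, walkState]
  | succ n ih => rw [walk_succ]; push_cast; split_ifs <;> omega

theorem visits_eq_zero {n : ℕ} {z : ℤ} (h : x + n < z) : visits ω U x n z = 0 := by
  induction n with
  | zero => simp [visits, walkState]
  | succ n ih =>
    push_cast at h
    have := walk_le ω U x n
    rw [visits_succ, ih (by omega), if_neg (by omega)]

/-- The part of an environment at and to the right of `k`. -/
def envFrom (ω : CEnv) (k : ℤ) : ℕ → ℕ → ℝ := fun j => ω (k + j)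

theorem shiftSeq_envFrom (k : ℤ) : shiftSeq (envFrom ω k) = envFrom ω (k + 1) := by
  funext j; simp only [shiftSeq, envFrom]; congr 1; push_cast; ring

theorem envFrom_zero (k : ℤ) : envFrom ω k 0 = ω k := by simp [envFrom]

theorem excur_succ_envFrom (j : ℕ) (k : ℤ) : excur (j + 1) (envFrom ω k) (envFrom U k) =
    leftsBefore (ω k) (U k) (excur j (envFrom ω (k + 1)) (envFrom U (k + 1)) + 1) := by
  rw [excur, shiftSeq_envFrom, shiftSeq_envFrom, envFrom_zero, envFrom_zero]

/-- If the walk is recurrent then so are the excursion walks far to the right. -/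
theorem excurSup_eq_top_of_mem_Rset (hinf : ∀ z, InfRight (ω z) (U z)) {y : ℤ}
    (h : walk ω U x ∈ Rset y) :
    excurSup (envFrom ω (max x y + 1)) (envFrom U (max x y + 1)) = ⊤ := by
  set k₀ := max x y
  have hx : x ≤ k₀ := le_max_left _ _
  have hk₀ := mem_Rset_of_le ω U x hinf h (le_max_right x y)
  have key : ∀ t, walk ω U x t = k₀ → ∀ (j : ℕ) (k : ℤ), k₀ ≤ k → x + t < k + j →
      (numLeft ω U x t k : ℝ≥0∞) ≤ excur j (envFrom ω k) (envFrom U k) := by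
    intro t ht j
    induction j with
    | zero =>
      intro k _ hk
      have h0 := visits_eq_zero ω U x (n := t) (z := k) (by simpa using hk)
      simp [numLeft, h0]
    | succ j ih =>
      intro k hk hkj
      have hf := flow ω U x t k
      rw [if_pos (by omega), if_pos (by omega)] at hf
      have hf' : numRight ω U x t k = numLeft ω U x t (k + 1) := by omega
      rw [excur_succ_envFrom]
      refine (numLeft_le ω U x t k).trans (leftsBefore_mono _ _ ?_)
      rw [hf']
      gcongr
      exact ih (k + 1) (by omega) (by push_cast at hkj; omega)
  refine ENNReal.eq_top_of_forall_nnreal_le fun r => ?_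
  obtain ⟨N, hN⟩ := exists_nat_ge r
  obtain ⟨n, hn⟩ := exists_le_numRight ω U x (hinf k₀) hk₀ N
  obtain ⟨t, hnt, ht⟩ := hk₀ n
  have h1 := numRight_mono ω U x k₀ hnt
  simp only at h1
  have hf := flow ω U x t k₀
  rw [if_pos (by omega), if_pos (by omega)] at hf
  have h2 : N ≤ numLeft ω U x t (k₀ + 1) := by omega
  obtain ⟨j, hj⟩ : ∃ j : ℕ, x + t < k₀ + 1 + j := ⟨t, by omega⟩
  calc (r : ℝ≥0∞) ≤ N := by exact_mod_cast hN
    _ ≤ numLeft ω U x t (k₀ + 1) := by exact_mod_cast h2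
    _ ≤ _ := key t ht j (k₀ + 1) (by omega) hj
    _ ≤ _ := excur_le_excurSup _ _ _

/-- The part of an environment to the left of `k`, read from right to left. -/
def envLeft (ω : CEnv) (k : ℤ) : ℕ → ℕ → ℝ := fun j => ω (k - 1 - j)

/-- If the iterated numbers of left arrows die out then the walk is unbounded above. -/
theorem exists_le_walk (hinf : ∀ z, InfRight (ω z) (U z))
    (hdie : ∀ m : ℕ, ∃ j, leftIter j (envLeft ω x) (envLeft U x) m = 0) (n : ℤ) :
    ∃ t, n ≤ walk ω U x t := by
  by_contra! hlt
  have hnot : ∀ z, walk ω U x ∉ Rset z := fun z hz => by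
    obtain ⟨t, -, ht⟩ := mem_Rset_of_le ω U x hinf hz (le_max_left z n) 0
    have := hlt t
    have := le_max_right z n
    omega
  have hev : ∀ z, ∀ᶠ t in atTop, walk ω U x t ≠ z := fun z => by
    have h := hnot z
    simp only [Rset, Set.mem_ofPred_eq, not_forall, not_exists] at h
    obtain ⟨N, hN⟩ := h
    exact eventually_atTop.2 ⟨N, fun t ht h => hN t ⟨ht, h⟩⟩
  have hlow : ∀ B : ℤ, ∃ t, walk ω U x t < B := fun B => by
    obtain ⟨t, ht⟩ := ((Finset.eventually_all (Finset.Ico B n)).2 fun z _ => hev z).exists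
    refine ⟨t, ?_⟩
    by_contra! h
    exact ht _ (Finset.mem_Ico.2 ⟨h, hlt t⟩) rfl
  obtain ⟨C, hC⟩ : ∃ C : ℕ, ∀ t, visits ω U x t x ≤ C := by
    have h := hnot x
    rw [mem_Rset_walk_iff] at h
    push Not at h
    exact h.imp fun N hN t => (hN t).le
  have key : ∀ (j : ℕ) t, walk ω U x t ≤ x - 1 - j → (numLeft ω U x t (x - 1 - j) : ℝ≥0∞)
      ≤ leftIter (j + 1) (envLeft ω x) (envLeft U x) C := by
    intro j t ht
    have hf := flow ω U x t (x - 1 - j)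
    rw [if_pos ht, if_neg (by omega)] at hf
    rw [leftIter_succ]
    refine (numLeft_le ω U x t _).trans (leftsBefore_mono _ _ ?_)
    have hf' : (numRight ω U x t (x - 1 - j) : ℝ≥0∞) + 1 = numLeft ω U x t (x - 1 - j + 1) := by
      exact_mod_cast (by omega : numRight ω U x t (x - 1 - j) + 1 = _)
    rw [hf']
    induction j with
    | zero =>
      have : x - 1 - ((0 : ℕ) : ℤ) + 1 = x := by simp
      rw [this]
      have h1 := numLeft_add ω U x t x
      have h2 := hC t
      change _ ≤ (C : ℝ≥0∞)
      exact_mod_cast (by omega : numLeft ω U x t x ≤ C)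
    | succ j ih =>
      have he : x - 1 - ((j + 1 : ℕ) : ℤ) + 1 = x - 1 - j := by push_cast; ring
      rw [he]
      have ht' : walk ω U x t ≤ x - 1 - j := by push_cast at ht; omega
      have hg := flow ω U x t (x - 1 - j)
      rw [if_pos ht', if_neg (by omega)] at hg
      have hg' : (numRight ω U x t (x - 1 - j) : ℝ≥0∞) + 1 = numLeft ω U x t (x - 1 - j + 1) := by
        exact_mod_cast (by omega : numRight ω U x t (x - 1 - j) + 1 = _)
      rw [leftIter_succ]
      refine (numLeft_le ω U x t _).trans (leftsBefore_mono _ _ ?_)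
      rw [hg']
      exact ih ht' hg hg'
  obtain ⟨j, hj⟩ := hdie C
  obtain ⟨t, ht⟩ := hlow (x - 1 - j)
  have h1 := key j t ht.le
  rw [leftIter_succ, hj, leftsBefore_zero] at h1
  have hf := flow ω U x t (x - 1 - j - 1)
  rw [if_pos (by omega), if_neg (by omega), sub_add_cancel] at hf
  have h2 : numLeft ω U x t (x - 1 - j) = 0 := by
    exact_mod_cast le_antisymm h1 zero_le
  omega

theorem exists_le_numLeft {k : ℤ} (hunb : ∀ n : ℤ, ∃ t, n ≤ walk ω U x t) (hk : x ≤ k)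
    (htop : excurSup (envFrom ω k) (envFrom U k) = ⊤) (N : ℕ) :
    ∃ t, N ≤ numLeft ω U x t k := by
  have key : ∀ t (j : ℕ) (k : ℤ), x ≤ k → k + j ≤ walk ω U x t →
      excur j (envFrom ω k) (envFrom U k) ≤ numLeft ω U x t k := by
    intro t j
    induction j with
    | zero => intro k _ _; exact zero_le
    | succ j ih =>
      intro k hk hkj
      push_cast at hkj
      have hf := flow ω U x t k
      rw [if_neg (by omega), if_pos hk] at hf
      rw [excur_succ_envFrom]
      refine le_trans (leftsBefore_mono _ _ ?_) (le_numLeft ω U x t k)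
      have hf' : (numRight ω U x t k : ℝ≥0∞) = numLeft ω U x t (k + 1) + 1 := by
        exact_mod_cast (by omega : numRight ω U x t k = _)
      rw [hf']
      gcongr
      exact ih (k + 1) (by omega) (by omega)
  have h1 : (N : ℝ≥0∞) < ⨆ j, excur j (envFrom ω k) (envFrom U k) := by
    change _ < excurSup _ _
    rw [htop]; exact ENNReal.natCast_lt_top N
  obtain ⟨j, hj⟩ := lt_iSup_iff.1 h1
  obtain ⟨t, ht⟩ := hunb (k + j)
  exact ⟨t, by exact_mod_cast hj.le.trans (key t j k hk ht)⟩

theorem exists_lefts_of_excurSup {e u : ℕ → ℕ → ℝ} (htop : excurSup e u = ⊤) (N : ℕ) :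
    ∃ i, N ≤ i - nRight (e 0) (u 0) i := by
  have h := excurSup_le e u
  rw [htop, leftsBefore, ENNReal.tsum_eq_iSup_nat] at h
  obtain ⟨i, hi⟩ := lt_iSup_iff.1 (lt_of_lt_of_le (ENNReal.natCast_lt_top N) h)
  refine ⟨i, ?_⟩
  have h2 := hi.le.trans (Finset.sum_le_sum (g := fun j => if ¬ u 0 j ≤ e 0 j then 1 else 0)
    fun j _ => by split_ifs <;> first | exact le_rfl | exact zero_le | tauto)
  rw [sum_lefts] at h2
  exact_mod_cast h2

theorem mem_Rset_pred {k : ℤ} (htop : excurSup (envFrom ω k) (envFrom U k) = ⊤)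
    (h : walk ω U x ∈ Rset k) : walk ω U x ∈ Rset (k - 1) := by
  rw [mem_Rset_walk_iff] at h ⊢
  intro N
  obtain ⟨i, hi⟩ := exists_lefts_of_excurSup htop (N + 1)
  rw [envFrom_zero, envFrom_zero] at hi
  obtain ⟨n, hn⟩ := h i
  have hmono : ∀ j, i ≤ j → N + 1 ≤ j - nRight (ω k) (U k) j := fun j hj => by
    induction j, hj using Nat.le_induction with
    | base => exact hi
    | succ j _ ih => rw [nRight]; split_ifs <;> omega
  have h1 : N + 1 ≤ numLeft ω U x n k := hmono _ hn
  have hf := flow ω U x n (k - 1)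
  rw [sub_add_cancel] at hf
  have h2 := numLeft_add ω U x n (k - 1)
  refine ⟨n, ?_⟩
  split_ifs at hf <;> omega

/-- If the excursion walks and the walk to the left of `x` are recurrent then so is the walk. -/
theorem mem_Rset_of_excurSup (hinf : ∀ z, InfRight (ω z) (U z))
    (hdie : ∀ m : ℕ, ∃ j, leftIter j (envLeft ω x) (envLeft U x) m = 0)
    (htop : ∀ k : ℤ, 0 ≤ k → excurSup (envFrom ω k) (envFrom U k) = ⊤) {y : ℤ} (hy : 0 ≤ y) :
    walk ω U x ∈ Rset y := by
  have hunb := exists_le_walk ω U x hinf hdie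
  have hle : y ≤ max x y := le_max_right _ _
  have h1 : walk ω U x ∈ Rset (max x y) := mem_Rset_of_numLeft ω U x
    (exists_le_numLeft ω U x hunb (le_max_left _ _) (htop _ (hy.trans hle)))
  obtain ⟨m, hm⟩ := Int.eq_ofNat_of_zero_le (sub_nonneg.2 hle)
  have h2 : max x y = y + m := by omega
  rw [h2] at h1
  clear hm h2
  induction m with
  | zero => simpa using h1
  | succ m ih =>
    refine ih ?_
    have := mem_Rset_pred ω U x (htop _ (by omega)) h1
    convert this using 2
    push_cast; ring

end Walk

/-- The law of a field of independent uniform variables on all sites. -/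
def arrowLaw : Measure CEnv := Measure.infinitePi fun _ : ℤ => siteLaw

instance : IsProbabilityMeasure arrowLaw := by unfold arrowLaw; infer_instance

section PathSpace

/-- The paths that agree with `y` up to time `n`. -/
def pathCyl (y : ℕ → ℤ) (n : ℕ) : Set (ℕ → ℤ) := {Y | ∀ m ≤ n, Y m = y m}

theorem measurableSet_pathCyl (y : ℕ → ℤ) (n : ℕ) : MeasurableSet (pathCyl y n) := by
  have : pathCyl y n = ⋂ m, ⋂ (_ : m ≤ n), (fun Y : ℕ → ℤ => Y m) ⁻¹' {y m} := by
    ext Y; simp [pathCyl]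
  rw [this]
  exact MeasurableSet.iInter fun m => MeasurableSet.iInter fun _ =>
    measurable_pi_apply m (measurableSet_singleton _)

theorem isPiSystem_pathCyl : IsPiSystem (range fun q : (ℕ → ℤ) × ℕ => pathCyl q.1 q.2) := by
  rintro _ ⟨⟨y, n⟩, rfl⟩ _ ⟨⟨y', n'⟩, rfl⟩ ⟨Y, hY, hY'⟩
  refine ⟨⟨Y, max n n'⟩, ?_⟩
  ext Z
  have hY1 : ∀ m ≤ n, Y m = y m := hY
  have hY2 : ∀ m ≤ n', Y m = y' m := hY'
  change (∀ m ≤ max n n', Z m = Y m) ↔ (∀ m ≤ n, Z m = y m) ∧ (∀ m ≤ n', Z m = y' m)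
  constructor
  · intro h
    exact ⟨fun m hm => (h m (le_max_of_le_left hm)).trans (hY1 m hm),
      fun m hm => (h m (le_max_of_le_right hm)).trans (hY2 m hm)⟩
  · rintro ⟨h1, h2⟩ m hm
    rcases le_max_iff.1 hm with h | h
    · exact (h1 m h).trans (hY1 m h).symm
    · exact (h2 m h).trans (hY2 m h).symm

theorem generateFrom_pathCyl :
    (MeasurableSpace.pi : MeasurableSpace (ℕ → ℤ))
      = MeasurableSpace.generateFrom (range fun q : (ℕ → ℤ) × ℕ => pathCyl q.1 q.2) := by
  apply le_antisymm
  · refine iSup_le fun a => ?_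
    rw [← measurable_iff_comap_le]
    refine @measurable_to_countable' ℤ (ℕ → ℤ) _ _ (MeasurableSpace.generateFrom _) _ fun z => ?_
    have : (fun Y : ℕ → ℤ => Y a) ⁻¹' {z}
        = ⋃ l : List ℤ, ⋃ (_ : l.getD a 0 = z), pathCyl (fun m => l.getD m 0) a := by
      ext Y
      simp only [mem_preimage, mem_singleton_iff, mem_iUnion, exists_prop]
      constructor
      · intro h
        have hl : ∀ m ≤ a, ((List.range (a + 1)).map Y).getD m 0 = Y m := by
          intro m hm
          rw [List.getD_eq_getElem _ _ (by simp; omega)]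
          simp
        exact ⟨(List.range (a + 1)).map Y, (hl a le_rfl).trans h, fun m hm => (hl m hm).symm⟩
      · rintro ⟨l, h1, h2⟩
        exact (h2 a le_rfl).trans h1
    rw [this]
    exact MeasurableSet.iUnion fun l => MeasurableSet.iUnion fun _ =>
      MeasurableSpace.measurableSet_generateFrom ⟨⟨_, a⟩, rfl⟩
  · refine MeasurableSpace.generateFrom_le ?_
    rintro _ ⟨⟨y, n⟩, rfl⟩
    exact measurableSet_pathCyl y n

theorem measurableSet_Rset (k : ℤ) : MeasurableSet (Rset k) := by
  have : Rset k = ⋂ N : ℕ, ⋃ n : ℕ, ⋃ (_ : n ≥ N), (fun Y : ℕ → ℤ => Y n) ⁻¹' {k} := by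
    ext Y; simp [Rset]
  rw [this]
  exact MeasurableSet.iInter fun N => MeasurableSet.iUnion fun n => MeasurableSet.iUnion fun _ =>
    measurable_pi_apply n (measurableSet_singleton _)

end PathSpace

theorem measurable_eval_pair {β : Type*} [MeasurableSpace β] :
    Measurable fun q : (ℤ × (ℤ → β)) => q.2 q.1 :=
  measurable_from_prod_countable_right fun z => measurable_pi_apply z

theorem measurable_walkState (ω : CEnv) (x : ℤ) (n : ℕ) :
    Measurable fun U : CEnv => walkState ω U x n := by
  induction n with
  | zero => exact measurable_const
  | succ n ih =>
    have hpos : Measurable fun U : CEnv => (walkState ω U x n).1 := measurable_fst.comp ih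
    have hcnt : Measurable fun U : CEnv => (walkState ω U x n).2 (walkState ω U x n).1 :=
      measurable_eval_pair.comp ih
    have hev : Measurable fun q : (ℤ × ℕ) × CEnv => q.2 q.1.1 q.1.2 :=
      measurable_from_prod_countable_right fun a =>
        (measurable_pi_apply a.2).comp (measurable_pi_apply a.1)
    have hw : Measurable fun q : ℤ × ℕ => ω q.1 q.2 := measurable_of_countable _
    have hU : Measurable fun U : CEnv =>
        U (walkState ω U x n).1 ((walkState ω U x n).2 (walkState ω U x n).1) :=
      hev.comp ((hpos.prodMk hcnt).prodMk measurable_id)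
    have hω : Measurable fun U : CEnv =>
        ω (walkState ω U x n).1 ((walkState ω U x n).2 (walkState ω U x n).1) :=
      hw.comp (hpos.prodMk hcnt)
    refine Measurable.prodMk ?_ ?_
    · exact Measurable.ite (measurableSet_le hU hω)
        ((measurable_of_countable fun z : ℤ => z + 1).comp hpos)
        ((measurable_of_countable fun z : ℤ => z - 1).comp hpos)
    · refine measurable_pi_iff.2 fun z => ?_
      exact ((measurable_pi_apply z).comp (measurable_snd.comp ih)).add
        (Measurable.ite (hpos (measurableSet_singleton z)) measurable_const measurable_const)

theorem measurable_walk (ω : CEnv) (x : ℤ) : Measurable fun U : CEnv => walk ω U x :=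
  measurable_pi_iff.2 fun n => measurable_fst.comp (measurable_walkState ω x n)

theorem visits_eq_card (ω U : CEnv) (x : ℤ) (n : ℕ) (z : ℤ) :
    visits ω U x n z = ((Finset.range n).filter fun m => walk ω U x m = z).card := by
  induction n with
  | zero => rfl
  | succ n ih =>
    rw [visits_succ, ih, Finset.range_add_one, Finset.filter_insert]
    split_ifs with h
    · rw [Finset.card_insert_of_notMem (by simp)]
    · rfl

theorem visits_of_agree {ω U : CEnv} {x : ℤ} {y : ℕ → ℤ} {n : ℕ}
    (h : ∀ m ≤ n, walk ω U x m = y m) : visits ω U x n (y n) = prevVisits y n := by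
  rw [visits_eq_card, prevVisits]
  congr 1
  refine Finset.filter_congr fun m hm => ?_
  rw [h m (Finset.mem_range.1 hm).le]

theorem prevVisits_lt {y : ℕ → ℤ} {m n : ℕ} (h : m < n) (hy : y m = y n) :
    prevVisits y m < prevVisits y n := by
  refine Finset.card_lt_card ⟨fun i hi => ?_, fun hs => ?_⟩
  · simp only [Finset.mem_filter, Finset.mem_range] at hi ⊢
    exact ⟨hi.1.trans h, hi.2.trans hy⟩
  · have : m ∈ (Finset.range m).filter fun i => y i = y m :=
      hs (by simp [h, hy])
    simp at this

theorem injective_visitIndex (y : ℕ → ℤ) :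
    Function.Injective fun m => (y m, prevVisits y m) := by
  intro m n h
  obtain ⟨h1, h2⟩ := Prod.ext_iff.1 h
  simp only at h1 h2
  rcases lt_trichotomy m n with hl | hl | hl
  · exact absurd h2 (prevVisits_lt hl h1).ne
  · exact hl
  · exact absurd h2 (prevVisits_lt hl h1.symm).ne'

/-- The values of the arrow used at time `m` that make the walk follow `y` at that step. -/
def stepSet (ω : CEnv) (y : ℕ → ℤ) (m : ℕ) : Set ℝ :=
  if y (m + 1) = y m + 1 then {w | w ≤ ω (y m) (prevVisits y m)}
  else if y (m + 1) = y m - 1 then {w | ¬ w ≤ ω (y m) (prevVisits y m)} else ∅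

theorem measurableSet_stepSet (ω : CEnv) (y : ℕ → ℤ) (m : ℕ) : MeasurableSet (stepSet ω y m) := by
  have h : MeasurableSet {w : ℝ | w ≤ ω (y m) (prevVisits y m)} :=
    measurableSet_le measurable_id measurable_const
  unfold stepSet
  split_ifs
  exacts [h, h.compl, MeasurableSet.empty]

theorem unifLaw_stepSet {ω : CEnv} (hω : IsCookieEnv ω) (y : ℕ → ℤ) (m : ℕ) :
    unifLaw (stepSet ω y m) = ENNReal.ofReal (stepProb ω y m) := by
  unfold stepSet stepProb
  split_ifs
  · exact unifLaw_Iic (half_to_unit (hω _ _))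
  · exact unifLaw_Ioi (half_to_unit (hω _ _))
  · simp

theorem stepProb_nonneg {ω : CEnv} (hω : IsCookieEnv ω) (y : ℕ → ℤ) (m : ℕ) :
    0 ≤ stepProb ω y m := by
  have := half_to_unit (hω (y m) (prevVisits y m))
  unfold stepProb
  split_ifs
  · exact this.1
  · linarith [this.2]
  · exact le_rfl

theorem walk_mem_pathCyl_iff (ω U : CEnv) (y : ℕ → ℤ) (n : ℕ) :
    walk ω U (y 0) ∈ pathCyl y n ↔
      ∀ m ∈ Finset.range n, U (y m) (prevVisits y m) ∈ stepSet ω y m := by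
  change (∀ m ≤ n, walk ω U (y 0) m = y m) ↔ _
  induction n with
  | zero => simp [walk, walkState]
  | succ n ih =>
    rw [Finset.range_add_one, Finset.forall_mem_insert, ← ih]
    have key : (∀ m ≤ n, walk ω U (y 0) m = y m) →
        (walk ω U (y 0) (n + 1) = y (n + 1) ↔ U (y n) (prevVisits y n) ∈ stepSet ω y n) := by
      intro h
      rw [walk_succ, h n le_rfl, visits_of_agree h]
      unfold stepSet
      by_cases hU : U (y n) (prevVisits y n) ≤ ω (y n) (prevVisits y n)
      · rw [if_pos hU]
        split_ifs with h1 h2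
        · simp [h1, hU]
        · simp only [mem_ofPred_eq, hU, not_true_eq_false, iff_false]; omega
        · simp only [mem_empty_iff_false, iff_false]; omega
      · rw [if_neg hU]
        split_ifs with h1 h2
        · simp only [mem_ofPred_eq, hU, iff_false]; omega
        · simpa [h2] using hU
        · simp only [mem_empty_iff_false, iff_false]; omega
    constructor
    · intro h
      have h' : ∀ m ≤ n, walk ω U (y 0) m = y m := fun m hm => h m (by omega)
      exact ⟨(key h').1 (h _ le_rfl), h'⟩
    · rintro ⟨h1, h2⟩ m hm
      rcases Nat.le_succ_iff.1 hm with h | rfl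
      · exact h2 m h
      · exact (key h2).2 h1

theorem arrowLaw_eval (z : ℤ) (i : ℕ) {B : Set ℝ} (hB : MeasurableSet B) :
    arrowLaw ((fun U : CEnv => U z i) ⁻¹' B) = unifLaw B := by
  have h1 : MeasurePreserving (fun U : CEnv => U z) arrowLaw siteLaw :=
    measurePreserving_eval_infinitePi (fun _ : ℤ => siteLaw) z
  have h2 : MeasurePreserving (fun v : ℕ → ℝ => v i) siteLaw unifLaw :=
    measurePreserving_eval_infinitePi (fun _ : ℕ => unifLaw) i
  exact (h2.comp h1).measure_preimage hB.nullMeasurableSet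

theorem arrowLaw_steps {ω : CEnv} (hω : IsCookieEnv ω) (y : ℕ → ℤ) (n : ℕ) :
    arrowLaw {U | ∀ m ∈ Finset.range n, U (y m) (prevVisits y m) ∈ stepSet ω y m}
      = ENNReal.ofReal (∏ m ∈ Finset.range n, stepProb ω y m) := by
  have hi : iIndepFun (fun (q : ℤ × ℕ) (U : CEnv) => U q.1 q.2) arrowLaw :=
    iIndepFun_uncurry_infinitePi' (X := fun _ _ w => w) (fun (_ : ℤ) (_ : ℕ) => unifLaw)
      fun _ _ => measurable_id
  have hi' := hi.precomp (injective_visitIndex y)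
  have h := hi'.measure_inter_preimage_eq_mul (Finset.range n) (sets := stepSet ω y)
    fun m _ => measurableSet_stepSet ω y m
  have hs : {U : CEnv | ∀ m ∈ Finset.range n, U (y m) (prevVisits y m) ∈ stepSet ω y m}
      = ⋂ m ∈ Finset.range n, (fun U : CEnv => U (y m) (prevVisits y m)) ⁻¹' stepSet ω y m := by
    ext U; simp
  rw [hs, ENNReal.ofReal_prod_of_nonneg fun m _ => stepProb_nonneg hω y m]
  refine h.trans (Finset.prod_congr rfl fun m _ => ?_)
  rw [← unifLaw_stepSet hω]
  exact arrowLaw_eval _ _ (measurableSet_stepSet ω y m)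

theorem arrowLaw_pathCyl {ω : CEnv} (hω : IsCookieEnv ω) (x : ℤ) (y : ℕ → ℤ) (n : ℕ) :
    arrowLaw ((fun U => walk ω U x) ⁻¹' pathCyl y n) = ENNReal.ofReal (cylProb ω x y n) := by
  by_cases hx : y 0 = x
  · subst hx
    rw [cylProb, if_pos rfl, one_mul, ← arrowLaw_steps hω]
    congr 1
    ext U
    exact walk_mem_pathCyl_iff ω U y n
  · have : (fun U => walk ω U x) ⁻¹' pathCyl y n = ∅ := by
      refine eq_empty_of_forall_notMem fun U (hU : ∀ m ≤ n, walk ω U x m = y m) => hx ?_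
      exact (hU 0 (Nat.zero_le _)).symm
    rw [this, cylProb, if_neg hx]
    simp

theorem IsERWLaw.eq_map_walk {ω : CEnv} (hω : IsCookieEnv ω) {x : ℤ} {P : Measure (ℕ → ℤ)}
    (hP : IsERWLaw ω x P) : P = arrowLaw.map fun U => walk ω U x := by
  have := hP.1
  have := Measure.isProbabilityMeasure_map (μ := arrowLaw) (measurable_walk ω x).aemeasurable
  refine ext_of_generate_finite _ generateFrom_pathCyl isPiSystem_pathCyl ?_ (by simp)
  rintro _ ⟨⟨y, n⟩, rfl⟩
  rw [Measure.map_apply (measurable_walk ω x) (measurableSet_pathCyl y n), arrowLaw_pathCyl hω]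
  exact hP.2 y n

theorem measure_eq_one_of_ae {α : Type*} [MeasurableSpace α] {μ : Measure α} [IsProbabilityMeasure μ]
    {s : Set α} (h : ∀ᵐ a ∂μ, a ∈ s) : μ s = 1 :=
  (measure_congr (eventuallyEq_univ.2 h)).trans measure_univ

theorem measurePreserving_envFrom (k : ℤ) :
    MeasurePreserving (fun U : CEnv => envFrom U k) arrowLaw fieldLaw :=
  measurePreserving_reindex_infinitePi siteLaw (g := fun j : ℕ => k + (j : ℤ))
    fun i j h => by simpa using h

theorem measurePreserving_envLeft (k : ℤ) :
    MeasurePreserving (fun U : CEnv => envLeft U k) arrowLaw fieldLaw :=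
  measurePreserving_reindex_infinitePi siteLaw (g := fun j : ℕ => k - 1 - (j : ℤ))
    fun i j h => by simpa using h

theorem ae_infRight_arrowLaw {ω : CEnv} (hω : IsCookieEnv ω) :
    ∀ᵐ U ∂arrowLaw, ∀ z, InfRight (ω z) (U z) := by
  refine ae_all_iff.2 fun z => ?_
  have h : MeasurePreserving (fun U : CEnv => U z) arrowLaw siteLaw :=
    measurePreserving_eval_infinitePi (fun _ : ℤ => siteLaw) z
  exact h.quasiMeasurePreserving.ae (ae_infRight (hω z))

theorem IsERWLaw.Rset_eq_one {ω : CEnv} (hω : IsCookieEnv ω) {x y : ℤ} {P : Measure (ℕ → ℤ)}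
    (hP : IsERWLaw ω x P) (hy : 0 ≤ y)
    (htop : ∀ k : ℕ, ∀ᵐ u ∂fieldLaw, excurSup (envFrom ω k) u = ⊤) : P (Rset y) = 1 := by
  rw [hP.eq_map_walk hω, Measure.map_apply (measurable_walk ω x) (measurableSet_Rset y)]
  refine measure_eq_one_of_ae ?_
  have h1 : ∀ᵐ U ∂arrowLaw, ∀ k : ℕ, excurSup (envFrom ω k) (envFrom U k) = ⊤ :=
    ae_all_iff.2 fun k => (measurePreserving_envFrom k).quasiMeasurePreserving.ae (htop k)
  have h2 : ∀ᵐ U ∂arrowLaw, ∀ m : ℕ, ∃ j, leftIter j (envLeft ω x) (envLeft U x) m = 0 :=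
    ae_all_iff.2 fun m => (measurePreserving_envLeft x).quasiMeasurePreserving.ae
      (ae_exists_leftIter_eq_zero (fun j i => hω _ i) m)
  filter_upwards [ae_infRight_arrowLaw hω, h1, h2] with U hinf ht hdie
  refine mem_Rset_of_excurSup ω U x hinf hdie (fun k hk => ?_) hy
  lift k to ℕ using hk
  exact ht k

theorem IsERWLaw.Rset_eq_zero {ω : CEnv} (hω : IsCookieEnv ω) {x y : ℤ} {P : Measure (ℕ → ℤ)}
    (hP : IsERWLaw ω x P) (hy : 0 ≤ y)
    (hfin : ∀ k : ℕ, ∀ᵐ u ∂fieldLaw, excurSup (envFrom ω k) u < ⊤) : P (Rset y) = 0 := by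
  rw [hP.eq_map_walk hω, Measure.map_apply (measurable_walk ω x) (measurableSet_Rset y)]
  refine measure_eq_zero_iff_ae_notMem.2 ?_
  obtain ⟨k, hk⟩ := Int.eq_ofNat_of_zero_le (show 0 ≤ max x y + 1 by omega)
  have h1 : ∀ᵐ U ∂arrowLaw, excurSup (envFrom ω k) (envFrom U k) < ⊤ :=
    (measurePreserving_envFrom k).quasiMeasurePreserving.ae (hfin k)
  filter_upwards [ae_infRight_arrowLaw hω, h1] with U hinf hf hU
  have := excurSup_eq_top_of_mem_Rset ω U x hinf hU
  rw [hk] at this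
  exact hf.ne this

theorem measurable_restrictNN : Measurable restrictNN :=
  measurable_pi_iff.2 fun x => measurable_pi_apply (x : ℤ)

theorem shiftSeq_iterate_restrictNN (k : ℕ) (ω : CEnv) :
    shiftSeq^[k] (restrictNN ω) = envFrom ω k := by
  funext j
  rw [shiftSeq_iterate_apply]
  simp [restrictNN, envFrom, add_comm]

theorem ae_forall_envFrom {Pr : Measure CEnv}
    (hs : MeasurePreserving shiftSeq (Pr.map restrictNN) (Pr.map restrictNN))
    {p : (ℕ → ℕ → ℝ) → Prop} (hp : ∀ᵐ e ∂(Pr.map restrictNN), p e) :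
    ∀ᵐ ω ∂Pr, ∀ k : ℕ, p (envFrom ω k) := by
  refine ae_all_iff.2 fun k => ?_
  have h := ae_of_ae_map measurable_restrictNN.aemeasurable
    ((hs.iterate k).quasiMeasurePreserving.ae hp)
  filter_upwards [h] with ω hω
  rwa [shiftSeq_iterate_restrictNN] at hω

theorem lintegral_siteDrift_restrictNN (Pr : Measure CEnv) :
    ∫⁻ e, siteDrift (e 0) ∂(Pr.map restrictNN) = ∫⁻ ω, cookieDrift ω 0 ∂Pr :=
  lintegral_map (f := fun e : ℕ → ℕ → ℝ => siteDrift (e 0))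
    (measurable_siteDrift.comp (measurable_pi_apply 0)) measurable_restrictNN

theorem ae_isHalfEnv_restrictNN {Pr : Measure CEnv} (h : ∀ᵐ ω ∂Pr, IsCookieEnv ω) :
    ∀ᵐ e ∂(Pr.map restrictNN), IsHalfEnv e := by
  have hm : MeasurableSet {e : ℕ → ℕ → ℝ | IsHalfEnv e} := by
    have : {e : ℕ → ℕ → ℝ | IsHalfEnv e}
        = ⋂ j, ⋂ i, (fun e : ℕ → ℕ → ℝ => e j i) ⁻¹' Set.Icc (1/2 : ℝ) 1 := by
      ext e; simp [IsHalfEnv]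
    rw [this]
    exact MeasurableSet.iInter fun j => MeasurableSet.iInter fun i =>
      ((measurable_pi_apply i).comp (measurable_pi_apply j)) measurableSet_Icc
  refine (ae_map_iff measurable_restrictNN.aemeasurable hm).2 ?_
  filter_upwards [h] with ω hω j i using hω j i

/-- Either the walk is recurrent and the expected drift at the origin is at most one, or it is
transient and the expected drift is larger than one. -/
theorem recurrent_or_transient (Pr : Measure CEnv) [IsProbabilityMeasure Pr]
    (hcookie : ∀ᵐ ω ∂Pr, IsCookieEnv ω)
    (hstat : IsStatErgEnv Pr)
    (hnondeg : Pr {ω | ω 0 = fun i => if i = 0 then (1 : ℝ) else 1/2} < 1)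
    (P : CEnv → ℤ → Measure (ℕ → ℤ))
    (hP : ∀ ω, IsCookieEnv ω → ∀ x, IsERWLaw ω x (P ω x)) :
    ((∀ y : ℤ, 0 ≤ y → ∀ᵐ ω ∂Pr, ∀ x, P ω x (Rset y) = 1) ∧ ∫⁻ ω, cookieDrift ω 0 ∂Pr ≤ 1) ∨
      ((∀ y : ℤ, 0 ≤ y → ∀ᵐ ω ∂Pr, ∀ x, P ω x (Rset y) = 0) ∧
        1 < ∫⁻ ω, cookieDrift ω 0 ∂Pr) := by
  have := Measure.isProbabilityMeasure_map (μ := Pr) measurable_restrictNN.aemeasurable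
  have he := ae_isHalfEnv_restrictNN hcookie
  have hs : MeasurePreserving shiftSeq (Pr.map restrictNN) (Pr.map restrictNN) :=
    hstat.toMeasurePreserving
  rw [← lintegral_siteDrift_restrictNN]
  rcases excurSup_dichotomy hstat he with htop | hfin
  · refine Or.inl ⟨fun y hy => ?_, lintegral_siteDrift_le_one hs he htop⟩
    filter_upwards [ae_forall_envFrom hs (Measure.ae_ae_of_ae_prod htop), hcookie]
      with ω h hω x using (hP ω hω x).Rset_eq_one hω hy h
  · refine Or.inr ⟨fun y hy => ?_, lt_of_not_ge fun hδ => ?_⟩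
    · filter_upwards [ae_forall_envFrom hs (Measure.ae_ae_of_ae_prod hfin), hcookie]
        with ω h hω x using (hP ω hω x).Rset_eq_zero hω hy h
    · have h := ae_of_ae_map measurable_restrictNN.aemeasurable
        (ae_degenerate_of_excurSup_lt_top hs he hfin hδ)
      exact hnondeg.ne (measure_eq_one_of_ae h)

/-- Theorem 16, second part. Assume `(ω(x))_{x≥0}` is stationary and
ergodic under `Pr` and `Pr[ω(0) = (1, 1/2, 1/2, …)] < 1`. Then the walk is recurrent
(every `y ≥ 0` is `Pr`-a.s. `ω`-recurrent) iff `𝔼[δ^0] ≤ 1`, and otherwise it is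
transient (every `y ≥ 0` is `Pr`-a.s. `ω`-transient). -/
theorem erw_recurrence_transience_criterion (Pr : Measure CEnv) [IsProbabilityMeasure Pr]
    (hcookie : ∀ᵐ ω ∂Pr, IsCookieEnv ω)
    (hstat : IsStatErgEnv Pr)
    (hnondeg : Pr {ω | ω 0 = fun i => if i = 0 then (1 : ℝ) else 1/2} < 1)
    (P : CEnv → ℤ → Measure (ℕ → ℤ))
    (hP : ∀ ω, IsCookieEnv ω → ∀ x, IsERWLaw ω x (P ω x)) :
    ((∀ y : ℤ, 0 ≤ y → ∀ᵐ ω ∂Pr, ∀ x, P ω x (Rset y) = 1) ↔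
        ∫⁻ ω, cookieDrift ω 0 ∂Pr ≤ 1) ∧
      ((∀ y : ℤ, 0 ≤ y → ∀ᵐ ω ∂Pr, ∀ x, P ω x (Rset y) = 0) ↔
        1 < ∫⁻ ω, cookieDrift ω 0 ∂Pr) := by
  have hexcl : (∀ y : ℤ, 0 ≤ y → ∀ᵐ ω ∂Pr, ∀ x, P ω x (Rset y) = 1) →
      ¬ ∀ y : ℤ, 0 ≤ y → ∀ᵐ ω ∂Pr, ∀ x, P ω x (Rset y) = 0 := by
    intro h1 h0
    obtain ⟨ω, hω1, hω0⟩ := ((h1 0 le_rfl).and (h0 0 le_rfl)).exists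
    exact one_ne_zero ((hω1 0).symm.trans (hω0 0))
  rcases recurrent_or_transient Pr hcookie hstat hnondeg P hP with ⟨h, hδ⟩ | ⟨h, hδ⟩
  · exact ⟨iff_of_true h hδ, iff_of_false (hexcl h) hδ.not_gt⟩
  · exact ⟨iff_of_false (fun h1 => hexcl h1 h) hδ.not_ge, iff_of_true h hδ⟩

end
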